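/- arXiv:2101.09867 — 2 statements merged into one kernel-verified Lean document; each statement's English description precedes it below -/
import Mathlib

section
/- Suppose M : ℝ → ℝ is real analytic on all of ℝ and M is not identically zero on [0,∞). Let K(t,s) := ∑_{j=1}^∞ ((-s)^j / j!) M^{*j}(t-s) on ℝ², with convolutions defined via signed interval integrals. Define the exceptional set I := { (t,t,τ,τ) : t ∈ ℝ, τ = 1/√2 or τ = −1/√2 } ∪ { (t,0,τ,0) : t ≥ 0, τ = 1 or τ = −1 }. Then for every (t₀,s₀) ∈ ℝ² with t₀ ≥ s₀ and every (v₁,v₂) ∈ ℝ² with v₁² + v₂² = 1 such that (t₀,s₀,v₁,v₂) ∉ I, there exists l ∈ ℕ such that the l-th derivative at r = 0 of the map r ↦ K(t₀ + r v₁, s₀ + r v₂) is nonzero. -/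
open Set MeasureTheory

/-- Convolution on `[0,∞)` (via signed interval integral): `(f*g)(t) = ∫_0^t f(t-s) g(s) ds`. -/
noncomputable def conv (f g : ℝ → ℝ) : ℝ → ℝ :=
  fun t => ∫ s in (0:ℝ)..t, f (t - s) * g s

/-- `j`-fold convolution power of `M`, with the conventions `M^{*0} = 0` and `M^{*1} = M`. -/
noncomputable def convPow (M : ℝ → ℝ) : ℕ → ℝ → ℝ
  | 0 => fun _ => 0
  | 1 => M
  | (j+2) => conv M (convPow M (j+1))

/-- The norm `‖f‖_{C^k([0,t])} = ∑_{l=0}^k max_{0 ≤ τ ≤ t} |f^{(l)}(τ)|`,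
derivatives taken within `[0,∞)`. -/
noncomputable def CkNorm (k : ℕ) (t : ℝ) (f : ℝ → ℝ) : ℝ :=
  ∑ l ∈ Finset.range (k+1), ⨆ τ : Set.Icc (0:ℝ) t, |iteratedDerivWithin l f (Set.Ici 0) τ|

/-- The flow kernel `K_M(t,s) = ∑_{j≥1} ((-s)^j / j!) M^{*j}(t-s)`. -/
noncomputable def KM (M : ℝ → ℝ) (t s : ℝ) : ℝ :=
  ∑' j : ℕ, ((-s) ^ j / (j.factorial : ℝ)) * convPow M j (t - s)

open Filter Topology in
theorem exists_local_holomorphic_extension {M : ℝ → ℝ} {x : ℝ} (hM : AnalyticAt ℝ M x) :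
    ∃ r > 0, ∃ m : ℂ → ℂ, DifferentiableOn ℂ m (Metric.ball (x : ℂ) r) ∧
      ∀ y : ℝ, (y : ℂ) ∈ Metric.ball (x : ℂ) r → m y = M y := by
  obtain ⟨p, R, hp⟩ := hM
  set q : FormalMultilinearSeries ℂ ℂ ℂ :=
    FormalMultilinearSeries.ofScalars ℂ (fun n => ((p.coeff n : ℝ) : ℂ)) with hq
  obtain ⟨r, hr0, hrR⟩ := ENNReal.lt_iff_exists_nnreal_btwn.mp hp.r_pos
  have hnorm : ∀ n, ‖q n‖ = ‖p n‖ := by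
    intro n
    rw [hq, FormalMultilinearSeries.ofScalars_norm, Complex.norm_real,
      FormalMultilinearSeries.norm_apply_eq_norm_coef]
  have hrad : R ≤ q.radius := by
    have : q.radius = p.radius := by
      simp only [FormalMultilinearSeries.radius, hnorm]
    rw [this]
    exact hp.r_le
  have hr0' : (0 : ENNReal) < r := hr0
  have hq' := (q.hasFPowerSeriesOnBall (hr0'.trans (hrR.trans_le hrad))).mono hr0'
    (hrR.trans_le hrad).le
  have hd : DifferentiableOn ℂ q.sum (Metric.ball 0 r) := by
    have := hq'.differentiableOn
    rwa [Metric.eball_coe] at this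
  refine ⟨r, by exact_mod_cast hr0', fun z => q.sum (z - x), ?_, ?_⟩
  · refine hd.comp (by fun_prop) ?_
    intro z hz
    simpa [dist_eq_norm] using hz
  · intro y hy
    have hy' : y ∈ Metric.ball x (r : ℝ) := by
      simpa [Complex.dist_eq, ← Complex.ofReal_sub, Real.dist_eq] using hy
    have hs := hp.hasSum_sub (y := y) (Metric.eball_subset_eball hrR.le (by rwa [Metric.eball_coe]))
    have hs' := Complex.hasSum_ofReal.mpr hs
    rw [← hs'.tsum_eq]
    simp only [FormalMultilinearSeries.sum]
    refine tsum_congr fun n => ?_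
    simp [hq]

theorem exists_holomorphic_extension {M : ℝ → ℝ} (hM : AnalyticOnNhd ℝ M univ) :
    ∃ (Ω : Set ℂ) (m : ℂ → ℂ), IsOpen Ω ∧ (∀ x : ℝ, (x : ℂ) ∈ Ω) ∧ DifferentiableOn ℂ m Ω ∧
      ∀ x : ℝ, m x = M x := by
  choose r hr m hm hmM using fun x : ℝ => exists_local_holomorphic_extension (hM x (mem_univ x))
  have key : ∀ (x y : ℝ), EqOn (m x) (m y) (Metric.ball (x : ℂ) (r x) ∩ Metric.ball (y : ℂ) (r y)) := by
    intro x y z hz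
    have hO : IsOpen (Metric.ball (x : ℂ) (r x) ∩ Metric.ball (y : ℂ) (r y)) :=
      Metric.isOpen_ball.inter Metric.isOpen_ball
    have hre : ∀ w : ℝ, dist ((z.re : ℝ) : ℂ) (w : ℂ) ≤ dist z w := by
      intro w
      rw [Complex.dist_eq, Complex.dist_eq, ← Complex.ofReal_sub, Complex.norm_real]
      simpa using Complex.abs_re_le_norm (z - w)
    have hzr : ((z.re : ℝ) : ℂ) ∈ Metric.ball (x : ℂ) (r x) ∩ Metric.ball (y : ℂ) (r y) :=
      ⟨(hre x).trans_lt hz.1, (hre y).trans_lt hz.2⟩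
    refine AnalyticOnNhd.eqOn_of_preconnected_of_frequently_eq
      (((hm x).mono inter_subset_left).analyticOnNhd hO)
      (((hm y).mono inter_subset_right).analyticOnNhd hO)
      ((convex_ball _ _).inter (convex_ball _ _)).isPreconnected hzr ?_ hz
    have ht : Filter.Tendsto (fun t : ℝ => ((z.re + t : ℝ) : ℂ)) (nhdsWithin 0 {0}ᶜ)
        (nhdsWithin ((z.re : ℝ) : ℂ) {((z.re : ℝ) : ℂ)}ᶜ) := by
      refine tendsto_nhdsWithin_iff.mpr ⟨?_, ?_⟩
      · refine tendsto_nhdsWithin_of_tendsto_nhds ?_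
        have : Continuous (fun t : ℝ => ((z.re + t : ℝ) : ℂ)) := by fun_prop
        simpa using this.tendsto 0
      · filter_upwards [self_mem_nhdsWithin] with t ht
        simpa using ht
    refine ht.frequently ?_
    refine Filter.Eventually.frequently ?_
    have := (ht.mono_right nhdsWithin_le_nhds).eventually (hO.mem_nhds hzr)
    filter_upwards [this] with t ht
    rw [hmM x _ ht.1, hmM y _ ht.2]
  classical
  refine ⟨⋃ x : ℝ, Metric.ball (x : ℂ) (r x),
    fun z => if h : ∃ x : ℝ, z ∈ Metric.ball (x : ℂ) (r x) then m h.choose z else 0,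
    isOpen_iUnion fun x => Metric.isOpen_ball, ?_, ?_, ?_⟩
  · exact fun x => mem_iUnion.mpr ⟨x, Metric.mem_ball_self (hr x)⟩
  · intro z hz
    obtain ⟨x, hx⟩ := mem_iUnion.mp hz
    have hnx := Metric.isOpen_ball.mem_nhds hx
    refine DifferentiableAt.differentiableWithinAt ?_
    refine ((hm x).differentiableAt hnx).congr_of_eventuallyEq ?_
    filter_upwards [hnx] with w hw
    have h : ∃ x : ℝ, w ∈ Metric.ball (x : ℂ) (r x) := ⟨x, hw⟩
    rw [dif_pos h]
    exact key _ _ ⟨h.choose_spec, hw⟩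
  · intro x
    have h : ∃ y : ℝ, (x : ℂ) ∈ Metric.ball (y : ℂ) (r y) := ⟨x, Metric.mem_ball_self (hr x)⟩
    simp only [dif_pos h]
    exact hmM _ _ h.choose_spec

theorem exists_starConvex_holomorphic_extension {M : ℝ → ℝ} (hM : AnalyticOnNhd ℝ M univ) :
    ∃ (U : Set ℂ) (m : ℂ → ℂ), IsOpen U ∧ StarConvex ℝ 0 U ∧ (∀ x : ℝ, (x : ℂ) ∈ U) ∧
      DifferentiableOn ℂ m U ∧ ∀ x : ℝ, m x = M x := by
  obtain ⟨Ω, m, hΩ, hR, hm, hmM⟩ := exists_holomorphic_extension hM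
  refine ⟨{z | ∀ u ∈ Icc (0 : ℝ) 1, u • z ∈ Ω}, m, ?_, ?_, ?_, ?_, hmM⟩
  · rw [isOpen_iff_eventually]
    intro z hz
    have := isCompact_Icc.eventually_forall_of_forall_eventually (x₀ := z)
      (P := fun (z : ℂ) (u : ℝ) => u • z ∈ Ω) (K := Icc (0 : ℝ) 1) ?_
    · exact this
    · intro u hu
      have hc : Continuous (fun p : ℂ × ℝ => p.2 • p.1) := by fun_prop
      exact hc.continuousAt.eventually (hΩ.mem_nhds (hz u hu))
  · rw [starConvex_zero_iff]
    intro z hz a ha0 ha1 u hu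
    rw [smul_smul]
    exact hz _ ⟨mul_nonneg hu.1 ha0, mul_le_one₀ hu.2 ha0 ha1⟩
  · intro x u hu
    have := hR (u * x)
    simpa using this
  · exact hm.mono fun z hz => by simpa using hz 1 (by simp)

/-- Convolution along the segment from `0` to `z`, rescaled to `[0,1]`. -/
noncomputable def segConv (f g : ℂ → ℂ) : ℂ → ℂ :=
  fun z => z * ∫ u in (0 : ℝ)..1, f ((1 - u) • z) * g (u • z)

/-- The convolution powers with respect to `segConv`, indexed as `convPow`. -/
noncomputable def segConvPow (m : ℂ → ℂ) : ℕ → ℂ → ℂ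
  | 0 => fun _ => 0
  | 1 => m
  | (j+2) => segConv m (segConvPow m (j+1))

open Filter Topology in
theorem differentiableOn_segConv {U : Set ℂ} (hU : IsOpen U) (hs : StarConvex ℝ 0 U)
    {f g : ℂ → ℂ} (hf : DifferentiableOn ℂ f U) (hg : DifferentiableOn ℂ g U) :
    DifferentiableOn ℂ (segConv f g) U := by
  rw [starConvex_zero_iff] at hs
  intro z₀ hz₀
  refine DifferentiableAt.differentiableWithinAt ?_
  refine differentiableAt_id.mul ?_
  obtain ⟨ε, hε, hεU⟩ := Metric.nhds_basis_closedBall.mem_iff.mp (hU.mem_nhds hz₀)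
  set K := Metric.closedBall z₀ ε ×ˢ Icc (0 : ℝ) 1 with hK
  have hKc : IsCompact K := (isCompact_closedBall _ _).prod isCompact_Icc
  have hm1 : MapsTo (fun p : ℂ × ℝ => (1 - p.2) • p.1) K U := fun p hp =>
    hs (hεU hp.1) (by linarith [hp.2.2]) (by linarith [hp.2.1])
  have hm2 : MapsTo (fun p : ℂ × ℝ => p.2 • p.1) K U := fun p hp =>
    hs (hεU hp.1) hp.2.1 hp.2.2
  have hc1 : ContinuousOn (fun p : ℂ × ℝ => (1 - p.2) • p.1) K := by fun_prop
  have hc2 : ContinuousOn (fun p : ℂ × ℝ => p.2 • p.1) K := by fun_prop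
  have hf' := (hf.deriv hU).continuousOn
  have hg' := (hg.deriv hU).continuousOn
  set F : ℂ → ℝ → ℂ := fun z u => f ((1 - u) • z) * g (u • z) with hF
  set F' : ℂ → ℝ → ℂ := fun z u =>
    (deriv f ((1 - u) • z) * ((1 - u : ℝ) : ℂ)) * g (u • z) +
      f ((1 - u) • z) * (deriv g (u • z) * (u : ℂ)) with hF'
  have hFc : ContinuousOn (fun p : ℂ × ℝ => F p.1 p.2) K :=
    (hf.continuousOn.comp hc1 hm1).mul (hg.continuousOn.comp hc2 hm2)
  have hF'c : ContinuousOn (fun p : ℂ × ℝ => F' p.1 p.2) K := by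
    refine ContinuousOn.add (ContinuousOn.mul (ContinuousOn.mul (hf'.comp hc1 hm1) ?_)
      (hg.continuousOn.comp hc2 hm2)) ((hf.continuousOn.comp hc1 hm1).mul
      (ContinuousOn.mul (hg'.comp hc2 hm2) ?_)) <;> fun_prop
  obtain ⟨B, hB⟩ := hKc.exists_bound_of_continuousOn hF'c
  have slice : ∀ {G : ℂ → ℝ → ℂ}, ContinuousOn (fun p : ℂ × ℝ => G p.1 p.2) K →
      ∀ z ∈ Metric.closedBall z₀ ε, ContinuousOn (G z) (Icc 0 1) := by
    intro G hG z hz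
    exact hG.comp (f := fun u : ℝ => (z, u)) (by fun_prop) fun u hu => ⟨hz, hu⟩
  have hIoc : uIoc (0 : ℝ) 1 ⊆ Icc 0 1 := by
    rw [uIoc_of_le zero_le_one]; exact Ioc_subset_Icc_self
  have hz₀' : z₀ ∈ Metric.closedBall z₀ ε := Metric.mem_closedBall_self hε.le
  have meas : ∀ {G : ℂ → ℝ → ℂ}, ContinuousOn (fun p : ℂ × ℝ => G p.1 p.2) K →
      ∀ z ∈ Metric.closedBall z₀ ε,
        AEStronglyMeasurable (G z) (volume.restrict (uIoc (0 : ℝ) 1)) := fun hG z hz =>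
    ((slice hG z hz).mono hIoc).aestronglyMeasurable measurableSet_uIoc
  refine (intervalIntegral.hasDerivAt_integral_of_dominated_loc_of_deriv_le (F := F) (F' := F')
    (bound := fun _ => B) (Metric.ball_mem_nhds z₀ hε) ?_ ?_ (meas hF'c z₀ hz₀') ?_ ?_
    ?_).2.differentiableAt
  · filter_upwards [Metric.ball_mem_nhds z₀ hε] with z hz
    exact meas hFc z (Metric.ball_subset_closedBall hz)
  · refine ContinuousOn.intervalIntegrable ?_
    rw [uIcc_of_le zero_le_one]
    exact slice hFc z₀ hz₀'
  · exact ae_of_all _ fun u hu z hz => hB (z, u) ⟨Metric.ball_subset_closedBall hz, hIoc hu⟩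
  · exact intervalIntegrable_const
  · refine ae_of_all _ fun u hu z hz => ?_
    have hp : (z, u) ∈ K := ⟨Metric.ball_subset_closedBall hz, hIoc hu⟩
    have h1 : HasDerivAt (fun z : ℂ => (1 - u) • z) ((1 - u : ℝ) : ℂ) z := by
      simpa using (hasDerivAt_id' z).const_mul ((1 - u : ℝ) : ℂ)
    have h2 : HasDerivAt (fun z : ℂ => u • z) (u : ℂ) z := by
      simpa using (hasDerivAt_id' z).const_mul (u : ℂ)
    have hf1 := (hf.differentiableAt (hU.mem_nhds (hm1 hp))).hasDerivAt
    have hg1 := (hg.differentiableAt (hU.mem_nhds (hm2 hp))).hasDerivAt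
    exact (hf1.comp z h1).mul (hg1.comp z h2)

theorem differentiableOn_segConvPow {U : Set ℂ} (hU : IsOpen U) (hs : StarConvex ℝ 0 U)
    {m : ℂ → ℂ} (hm : DifferentiableOn ℂ m U) :
    ∀ j, DifferentiableOn ℂ (segConvPow m j) U
  | 0 => differentiableOn_const 0
  | 1 => hm
  | (j+2) => differentiableOn_segConv hU hs hm (differentiableOn_segConvPow hU hs hm (j+1))

theorem segConv_ofReal {f g : ℂ → ℂ} {F G : ℝ → ℝ} (hf : ∀ x : ℝ, f x = F x)
    (hg : ∀ x : ℝ, g x = G x) (x : ℝ) : segConv f g x = conv F G x := by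
  have h := intervalIntegral.smul_integral_comp_mul_left (a := 0) (b := 1)
    (fun s : ℝ => F (x - s) * G s) x
  simp only [mul_zero, mul_one, smul_eq_mul] at h
  rw [segConv, conv, ← h]
  push_cast
  rw [← intervalIntegral.integral_ofReal]
  congr 1
  refine intervalIntegral.integral_congr fun u _ => ?_
  have h1 : (1 - u) • (x : ℂ) = ((x - x * u : ℝ) : ℂ) := by
    rw [Complex.real_smul]; push_cast; ring
  have h2 : u • (x : ℂ) = ((x * u : ℝ) : ℂ) := by
    rw [Complex.real_smul]; push_cast; ring
  simp only [h1, h2, hf, hg]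
  push_cast
  ring

theorem segConvPow_ofReal {m : ℂ → ℂ} {M : ℝ → ℝ} (hm : ∀ x : ℝ, m x = M x) :
    ∀ (j : ℕ) (x : ℝ), segConvPow m j x = convPow M j x
  | 0, _ => by simp [segConvPow, convPow]
  | 1, x => hm x
  | (j+2), x => segConv_ofReal hm (segConvPow_ofReal hm (j+1)) x

theorem norm_segConvPow_le {S : Set ℂ} (hs : StarConvex ℝ 0 S) {m : ℂ → ℂ} {B R : ℝ}
    (hB : ∀ z ∈ S, ‖m z‖ ≤ B) (hR : ∀ z ∈ S, ‖z‖ ≤ R) (j : ℕ) {z : ℂ} (hz : z ∈ S) :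
    ‖segConvPow m (j + 1) z‖ ≤ B ^ (j + 1) * R ^ j := by
  rw [starConvex_zero_iff] at hs
  have hB0 : 0 ≤ B := (norm_nonneg _).trans (hB z hz)
  have hR0 : 0 ≤ R := (norm_nonneg _).trans (hR z hz)
  induction j generalizing z with
  | zero => simpa [segConvPow] using hB z hz
  | succ j ih =>
    have hint : ‖∫ u in (0 : ℝ)..1, m ((1 - u) • z) * segConvPow m (j + 1) (u • z)‖
        ≤ B * (B ^ (j + 1) * R ^ j) * |1 - 0| := by
      refine intervalIntegral.norm_integral_le_of_norm_le_const fun u hu => ?_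
      rw [uIoc_of_le zero_le_one] at hu
      rw [norm_mul]
      exact mul_le_mul (hB _ (hs hz (by linarith [hu.2]) (by linarith [hu.1])))
        (ih (hs hz hu.1.le hu.2)) (norm_nonneg _) hB0
    rw [segConvPow, segConv, norm_mul]
    refine (mul_le_mul (hR z hz) hint (norm_nonneg _) hR0).trans_eq ?_
    simp only [sub_zero, abs_one]
    ring

theorem norm_segConvPow_le_pow {S : Set ℂ} (hs : StarConvex ℝ 0 S) {m : ℂ → ℂ} {B R : ℝ}
    (hB : ∀ z ∈ S, ‖m z‖ ≤ B) (hR : ∀ z ∈ S, ‖z‖ ≤ R) (hR1 : 1 ≤ R) (j : ℕ) {z : ℂ}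
    (hz : z ∈ S) : ‖segConvPow m j z‖ ≤ (B * R) ^ j := by
  cases j with
  | zero => simp [segConvPow]
  | succ j =>
    have hB0 : 0 ≤ B := (norm_nonneg _).trans (hB z hz)
    refine (norm_segConvPow_le hs hB hR j hz).trans ?_
    rw [mul_pow]
    gcongr
    exact j.le_succ

theorem analyticAt_KM_line {M : ℝ → ℝ} (hM : AnalyticOnNhd ℝ M univ) (t₀ s₀ v₁ v₂ x : ℝ) :
    AnalyticAt ℝ (fun r : ℝ => KM M (t₀ + r * v₁) (s₀ + r * v₂)) x := by
  obtain ⟨U, m, hU, hs, hR, hm, hmM⟩ := exists_starConvex_holomorphic_extension hM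
  set ℓ : ℂ → ℂ := fun z => ((t₀ - s₀ : ℝ) : ℂ) + z * ((v₁ - v₂ : ℝ) : ℂ) with hℓ
  set G : ℂ → ℂ := fun z => ∑' j : ℕ,
    ((-((s₀ : ℂ) + z * (v₂ : ℂ))) ^ j / (j.factorial : ℂ)) * segConvPow m j (ℓ z) with hG
  have hGr : ∀ r : ℝ, G r = ((KM M (t₀ + r * v₁) (s₀ + r * v₂) : ℝ) : ℂ) := by
    intro r
    simp only [hG, hℓ, KM]
    rw [Complex.ofReal_tsum]
    refine tsum_congr fun j => ?_
    have h : ((t₀ - s₀ : ℝ) : ℂ) + (r : ℂ) * ((v₁ - v₂ : ℝ) : ℂ)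
        = ((t₀ + r * v₁ - (s₀ + r * v₂) : ℝ) : ℂ) := by push_cast; ring
    rw [h, segConvPow_ofReal hmM]
    push_cast
    rfl
  suffices h : AnalyticAt ℂ G x by
    have := h.re_ofReal
    simpa only [hGr, Complex.ofReal_re] using this
  have hℓx : ℓ x ∈ U := by
    have := hR (t₀ - s₀ + x * (v₁ - v₂))
    simpa [hℓ] using this
  have hℓc : Continuous ℓ := by fun_prop
  obtain ⟨δ, hδ, hδU⟩ := Metric.nhds_basis_closedBall.mem_iff.mp (hU.mem_nhds hℓx)
  set S : Set ℂ := (fun p : ℝ × ℂ => p.1 • p.2) '' (Icc 0 1 ×ˢ Metric.closedBall (ℓ x) δ) with hS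
  have hSc : IsCompact S := (isCompact_Icc.prod (isCompact_closedBall _ _)).image (by fun_prop)
  have hSU : S ⊆ U := by
    rintro _ ⟨⟨u, w⟩, ⟨hu, hw⟩, rfl⟩
    exact starConvex_zero_iff.mp hs (hδU hw) hu.1 hu.2
  have hSs : StarConvex ℝ 0 S := by
    rw [starConvex_zero_iff]
    rintro _ ⟨⟨u, w⟩, ⟨hu, hw⟩, rfl⟩ a ha0 ha1
    exact ⟨(a * u, w), ⟨⟨mul_nonneg ha0 hu.1, mul_le_one₀ ha1 hu.1 hu.2⟩, hw⟩, by
      simp [mul_assoc]⟩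
  have hballS : Metric.closedBall (ℓ x) δ ⊆ S := fun w hw =>
    ⟨(1, w), ⟨by simp, hw⟩, by simp⟩
  obtain ⟨B, hB⟩ := hSc.exists_bound_of_continuousOn (hm.continuousOn.mono hSU)
  obtain ⟨R, hRb⟩ := hSc.exists_bound_of_continuousOn (f := fun z : ℂ => z) continuousOn_id
  obtain ⟨C, hC⟩ := (isCompact_closedBall (x : ℂ) 1).exists_bound_of_continuousOn
    (f := fun z : ℂ => -((s₀ : ℂ) + z * (v₂ : ℂ))) (by fun_prop)
  set V : Set ℂ := ℓ ⁻¹' Metric.ball (ℓ x) δ ∩ Metric.ball (x : ℂ) 1 with hV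
  have hVo : IsOpen V := (Metric.isOpen_ball.preimage hℓc).inter Metric.isOpen_ball
  have hxV : (x : ℂ) ∈ V := ⟨Metric.mem_ball_self hδ, Metric.mem_ball_self one_pos⟩
  have hℓU : MapsTo ℓ V U := fun z hz => hδU (Metric.ball_subset_closedBall hz.1)
  have hdiff : DifferentiableOn ℂ G V := by
    refine Complex.differentiableOn_tsum_of_summable_norm
      (u := fun j : ℕ => (C * (B * max R 1)) ^ j / (j.factorial : ℝ))
      (Real.summable_pow_div_factorial _) ?_ hVo ?_
    · intro j
      refine DifferentiableOn.mul (by fun_prop) ?_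
      exact (differentiableOn_segConvPow hU hs hm j).comp (by fun_prop) hℓU
    · intro j z hz
      have h1 := hC z (Metric.ball_subset_closedBall hz.2)
      have h2 := norm_segConvPow_le_pow hSs hB (fun w hw => (hRb w hw).trans (le_max_left R 1))
        (le_max_right R 1) j (hballS (Metric.ball_subset_closedBall hz.1))
      rw [norm_mul, norm_div, norm_pow, Complex.norm_natCast, mul_pow C, div_mul_eq_mul_div]
      have hC0 : 0 ≤ C := (norm_nonneg _).trans h1
      gcongr
  exact hdiff.analyticAt (hVo.mem_nhds hxV)

theorem KM_line_eq_zero {M : ℝ → ℝ} (hM : AnalyticOnNhd ℝ M univ) {t₀ s₀ v₁ v₂ : ℝ}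
    (h0 : ∀ l : ℕ, iteratedDeriv l (fun r : ℝ => KM M (t₀ + r * v₁) (s₀ + r * v₂)) 0 = 0)
    (r : ℝ) : KM M (t₀ + r * v₁) (s₀ + r * v₂) = 0 := by
  have han : AnalyticOnNhd ℝ (fun r : ℝ => KM M (t₀ + r * v₁) (s₀ + r * v₂)) univ :=
    fun x _ => analyticAt_KM_line hM t₀ s₀ v₁ v₂ x
  have hp := (han 0 (mem_univ 0)).hasFPowerSeriesAt
  have hz : FormalMultilinearSeries.ofScalars ℝ (fun n : ℕ =>
      iteratedDeriv n (fun r : ℝ => KM M (t₀ + r * v₁) (s₀ + r * v₂)) 0 / (n.factorial : ℝ)) = 0 := by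
    ext n
    simp [h0]
  rw [hz] at hp
  exact han.eqOn_zero_of_preconnected_of_eventuallyEq_zero isPreconnected_univ (mem_univ 0)
    hp.eventually_eq_zero (mem_univ r)

theorem continuous_convPow {M : ℝ → ℝ} (hM : AnalyticOnNhd ℝ M univ) (j : ℕ) :
    Continuous (convPow M j) := by
  obtain ⟨U, m, hU, hs, hR, hm, hmM⟩ := exists_starConvex_holomorphic_extension hM
  have h : Continuous fun x : ℝ => segConvPow m j x :=
    (differentiableOn_segConvPow hU hs hm j).continuousOn.comp_continuous
      Complex.continuous_ofReal hR
  have h2 := Complex.continuous_re.comp h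
  refine h2.congr fun x => ?_
  simp [segConvPow_ofReal hmM]

theorem abs_convPow_le {M : ℝ → ℝ} {A T : ℝ} {k : ℕ} (hA : 0 ≤ A)
    (hM : ∀ x ∈ Icc 0 T, |M x| ≤ A * x ^ k) (j : ℕ) {x : ℝ} (hx : x ∈ Icc 0 T) :
    |convPow M (j + 1) x| ≤ A ^ (j + 1) * x ^ ((k + 1) * j + k) := by
  induction j generalizing x with
  | zero => simpa [convPow] using hM x hx
  | succ j ih =>
    have h : ‖∫ s in (0:ℝ)..x, M (x - s) * convPow M (j + 1) s‖
        ≤ ((A * x ^ k) * (A ^ (j + 1) * x ^ ((k + 1) * j + k))) * |x - 0| := by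
      refine intervalIntegral.norm_integral_le_of_norm_le_const fun s hs => ?_
      rw [uIoc_of_le hx.1] at hs
      have hs0 := hs.1.le
      have hsx := hs.2
      have hxT := hx.2
      have hx0 := hx.1
      rw [norm_mul, Real.norm_eq_abs, Real.norm_eq_abs]
      refine mul_le_mul ((hM _ ⟨by linarith, by linarith⟩).trans ?_)
        ((ih ⟨hs0, by linarith⟩).trans ?_) (abs_nonneg _) (by positivity)
      · have : 0 ≤ x - s := by linarith
        gcongr
        linarith
      · gcongr
    rw [convPow, conv]
    refine h.trans_eq ?_
    rw [sub_zero, abs_of_nonneg hx.1]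
    ring

theorem integral_pow_div_factorial_mul (m n : ℕ) (x : ℝ) :
    ∫ s in (0:ℝ)..x, ((x - s) ^ m / (m.factorial : ℝ)) * (s ^ n / (n.factorial : ℝ))
      = x ^ (m + n + 1) / ((m + n + 1).factorial : ℝ) := by
  have hder : ∀ (n : ℕ) (s : ℝ),
      HasDerivAt (fun s : ℝ => s ^ (n + 1) / ((n + 1).factorial : ℝ))
        (s ^ n / (n.factorial : ℝ)) s := by
    intro n s
    refine ((hasDerivAt_pow (n + 1) s).div_const _).congr_deriv ?_
    have := n.factorial_ne_zero
    rw [Nat.factorial_succ]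
    push_cast
    field_simp
  induction m generalizing n with
  | zero =>
    have := n.factorial_ne_zero
    simp only [pow_zero, Nat.factorial_zero, Nat.cast_one, div_one, one_mul, zero_add]
    rw [intervalIntegral.integral_div, integral_pow, Nat.factorial_succ]
    push_cast
    field_simp
    simp
  | succ m ih =>
    have hu : ∀ s ∈ uIcc 0 x, HasDerivAt (fun s : ℝ => (x - s) ^ (m + 1) / ((m + 1).factorial : ℝ))
        (-((x - s) ^ m / (m.factorial : ℝ))) s := by
      intro s _
      have h := (hder m (x - s)).comp s ((hasDerivAt_id s).const_sub x)
      simpa [Function.comp_def] using h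
    have hv : ∀ s ∈ uIcc 0 x, HasDerivAt (fun s : ℝ => s ^ (n + 1) / ((n + 1).factorial : ℝ))
        (s ^ n / (n.factorial : ℝ)) s := fun s _ => hder n s
    rw [intervalIntegral.integral_mul_deriv_eq_deriv_mul hu hv
      (Continuous.intervalIntegrable (by fun_prop) _ _)
      (Continuous.intervalIntegrable (by fun_prop) _ _)]
    simp only [neg_mul, intervalIntegral.integral_neg, ih]
    rw [show m + (n + 1) + 1 = m + 1 + n + 1 by ring]
    simp

/-- Growth of the error when a kernel is a relative `O(x ^ 2)` perturbation of a monomial. -/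
theorem abs_convPow_sub_monomial_le {N : ℝ → ℝ} {a c G : ℝ} {k : ℕ}
    (hcont : ∀ j, Continuous (convPow N j)) (hG : 0 ≤ G)
    (hN : ∀ x ∈ Icc 0 a, |N x - c * (x ^ k / (k.factorial : ℝ))|
      ≤ |c| * G * (x ^ (k + 2) / ((k + 2).factorial : ℝ)))
    (j : ℕ) {x : ℝ} (hx : x ∈ Icc 0 a) :
    |convPow N (j + 1) x
        - c ^ (j + 1) * (x ^ ((k + 1) * j + k) / (((k + 1) * j + k).factorial : ℝ))|
      ≤ |c| ^ (j + 1) * (G * (j + 1) * Real.exp (G * a ^ 2 * (2 - 1 / (j + 1)))) *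
        (x ^ ((k + 1) * j + k + 2) / (((k + 1) * j + k + 2).factorial : ℝ)) := by
  induction j generalizing x with
  | zero =>
    have h := hN x hx
    have h1 : 1 ≤ Real.exp (G * a ^ 2) := Real.one_le_exp (by positivity)
    have hx0 := hx.1
    simp only [zero_add, convPow, mul_zero, pow_one]
    refine h.trans ?_
    gcongr
    norm_num
    nlinarith
  | succ j ih =>
    set n := (k + 1) * j + k with hn
    have hn' : (k + 1) * (j + 1) + k = k + n + 1 := by rw [hn]; ring
    set E := G * (j + 1) * Real.exp (G * a ^ 2 * (2 - 1 / (j + 1))) with hE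
    have hE0 : 0 ≤ E := by positivity
    have hx0 := hx.1
    have hxa := hx.2
    have hNc : Continuous N := hcont 1
    have hpt : ∀ s ∈ Ioc 0 x, ‖N (x - s) * convPow N (j + 1) s
        - c ^ (j + 2) * (((x - s) ^ k / (k.factorial : ℝ)) * (s ^ n / (n.factorial : ℝ)))‖
        ≤ |c| ^ (j + 2) * (G * E) * (((x - s) ^ (k + 2) / ((k + 2).factorial : ℝ)) *
              (s ^ (n + 2) / ((n + 2).factorial : ℝ)))
          + |c| ^ (j + 2) * E * (((x - s) ^ k / (k.factorial : ℝ)) *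
              (s ^ (n + 2) / ((n + 2).factorial : ℝ)))
          + |c| ^ (j + 2) * G * (((x - s) ^ (k + 2) / ((k + 2).factorial : ℝ)) *
              (s ^ n / (n.factorial : ℝ))) := by
      intro s hs
      have hs0 := hs.1.le
      have hxs : 0 ≤ x - s := by linarith [hs.2]
      have h1 := hN (x - s) ⟨hxs, by linarith⟩
      have h2 := ih (x := s) ⟨hs0, by linarith [hs.2]⟩
      have e : N (x - s) * convPow N (j + 1) s
          - c ^ (j + 2) * (((x - s) ^ k / (k.factorial : ℝ)) * (s ^ n / (n.factorial : ℝ)))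
          = (N (x - s) - c * ((x - s) ^ k / (k.factorial : ℝ))) *
              (convPow N (j + 1) s - c ^ (j + 1) * (s ^ n / (n.factorial : ℝ)))
            + (c * ((x - s) ^ k / (k.factorial : ℝ))) *
              (convPow N (j + 1) s - c ^ (j + 1) * (s ^ n / (n.factorial : ℝ)))
            + (N (x - s) - c * ((x - s) ^ k / (k.factorial : ℝ))) *
              (c ^ (j + 1) * (s ^ n / (n.factorial : ℝ))) := by ring
      have ha1 : |c * ((x - s) ^ k / (k.factorial : ℝ))| = |c| * ((x - s) ^ k / (k.factorial : ℝ)) := by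
        rw [abs_mul, abs_of_nonneg (a := (x - s) ^ k / (k.factorial : ℝ)) (by positivity)]
      have ha2 : |c ^ (j + 1) * (s ^ n / (n.factorial : ℝ))|
          = |c| ^ (j + 1) * (s ^ n / (n.factorial : ℝ)) := by
        rw [abs_mul, abs_pow, abs_of_nonneg (a := s ^ n / (n.factorial : ℝ)) (by positivity)]
      rw [e, Real.norm_eq_abs]
      refine (abs_add_three _ _ _).trans ?_
      rw [abs_mul, abs_mul (c * _), abs_mul (N _ - _), ha1, ha2]
      refine (add_le_add_three (mul_le_mul h1 h2 (abs_nonneg _) (by positivity))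
        (mul_le_mul_of_nonneg_left h2 (by positivity))
        (mul_le_mul_of_nonneg_right h1 (by positivity))).trans_eq ?_
      ring
    have heq : convPow N (j + 1 + 1) x
        - c ^ (j + 2) * (x ^ (k + n + 1) / ((k + n + 1).factorial : ℝ))
        = ∫ s in (0:ℝ)..x, (N (x - s) * convPow N (j + 1) s
          - c ^ (j + 2) * (((x - s) ^ k / (k.factorial : ℝ)) * (s ^ n / (n.factorial : ℝ)))) := by
      have hc := hcont (j + 1)
      rw [intervalIntegral.integral_sub (Continuous.intervalIntegrable (by fun_prop) _ _)
        (Continuous.intervalIntegrable (by fun_prop) _ _), intervalIntegral.integral_const_mul,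
        integral_pow_div_factorial_mul]
      rfl
    have hint := intervalIntegral.norm_integral_le_of_norm_le hx0 (ae_of_all volume hpt)
      (Continuous.intervalIntegrable (by fun_prop) _ _)
    rw [intervalIntegral.integral_add (Continuous.intervalIntegrable (by fun_prop) _ _)
        (Continuous.intervalIntegrable (by fun_prop) _ _),
      intervalIntegral.integral_add (Continuous.intervalIntegrable (by fun_prop) _ _)
        (Continuous.intervalIntegrable (by fun_prop) _ _),
      intervalIntegral.integral_const_mul, intervalIntegral.integral_const_mul,
      intervalIntegral.integral_const_mul, integral_pow_div_factorial_mul,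
      integral_pow_div_factorial_mul, integral_pow_div_factorial_mul, ← heq,
      show k + 2 + (n + 2) + 1 = k + n + 1 + 2 + 2 by ring,
      show k + (n + 2) + 1 = k + n + 1 + 2 by ring,
      show k + 2 + n + 1 = k + n + 1 + 2 by ring, Real.norm_eq_abs] at hint
    rw [hn']
    refine hint.trans ?_
    set q := k + n + 1 + 2 with hq
    have hjq : (j : ℝ) + 2 ≤ q := by
      have : j + 2 ≤ q := by
        rw [hq, hn]; nlinarith [Nat.zero_le (k * j)]
      exact_mod_cast this
    have hq2 : x ^ (q + 2) / ((q + 2).factorial : ℝ)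
        ≤ (a ^ 2 / (j + 2) ^ 2) * (x ^ q / (q.factorial : ℝ)) := by
      have hf : ((q + 2).factorial : ℝ) = (q + 2) * (q + 1) * q.factorial := by
        rw [Nat.factorial_succ, Nat.factorial_succ]; push_cast; ring
      rw [hf, pow_add, div_mul_div_comm, mul_comm (x ^ q)]
      have hq0 : (0 : ℝ) < q.factorial := by exact_mod_cast q.factorial_pos
      gcongr
      nlinarith
    have hj0 : (0 : ℝ) < (j : ℝ) + 1 := by positivity
    set β := G * a ^ 2 with hβ
    have hβ0 : 0 ≤ β := by positivity
    have hEE : G * E * (a ^ 2 / (j + 2) ^ 2) + E + G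
        ≤ G * ((j + 1 : ℕ) + 1) * Real.exp (β * (2 - 1 / ((j + 1 : ℕ) + 1))) := by
      have e1 : 1 + β / (j + 2) ^ 2 ≤ Real.exp (β / (j + 2) ^ 2) := by
        linarith [Real.add_one_le_exp (β / ((j : ℝ) + 2) ^ 2)]
      have e2 : β * (2 - 1 / ((j : ℝ) + 1)) + β / (j + 2) ^ 2 ≤ β * (2 - 1 / ((j : ℝ) + 2)) := by
        have : 1 / ((j : ℝ) + 2) ^ 2 ≤ 1 / ((j : ℝ) + 1) - 1 / ((j : ℝ) + 2) := by
          rw [div_sub_div _ _ (by positivity) (by positivity),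
            div_le_div_iff₀ (by positivity) (by positivity)]
          nlinarith
        rw [div_eq_mul_one_div β]
        nlinarith
      have e3 : E * (1 + β / (j + 2) ^ 2) ≤ G * (j + 1) * Real.exp (β * (2 - 1 / ((j : ℝ) + 2))) := by
        refine (mul_le_mul_of_nonneg_left e1 hE0).trans ?_
        rw [hE, mul_assoc (G * ((j : ℝ) + 1)), ← Real.exp_add]
        gcongr
      have e4 : 1 ≤ Real.exp (β * (2 - 1 / ((j : ℝ) + 2))) := by
        rw [Real.one_le_exp_iff]
        refine mul_nonneg hβ0 ?_
        have : 1 / ((j : ℝ) + 2) ≤ 1 := by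
          rw [div_le_one (by positivity)]; linarith
        linarith
      have e5 : ((j + 1 : ℕ) : ℝ) + 1 = (j : ℝ) + 2 := by push_cast; ring
      rw [e5]
      calc G * E * (a ^ 2 / (j + 2) ^ 2) + E + G = E * (1 + β / (j + 2) ^ 2) + G := by
            rw [hβ]; ring
        _ ≤ G * (j + 1) * Real.exp (β * (2 - 1 / ((j : ℝ) + 2)))
            + G * Real.exp (β * (2 - 1 / ((j : ℝ) + 2))) := by
            gcongr
            nlinarith
        _ = _ := by ring
    have hP : 0 ≤ x ^ q / (q.factorial : ℝ) := by positivity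
    calc _ ≤ |c| ^ (j + 2) * (G * E) * ((a ^ 2 / (j + 2) ^ 2) * (x ^ q / (q.factorial : ℝ)))
          + |c| ^ (j + 2) * E * (x ^ q / (q.factorial : ℝ))
          + |c| ^ (j + 2) * G * (x ^ q / (q.factorial : ℝ)) := by gcongr
      _ = |c| ^ (j + 2) * (G * E * (a ^ 2 / (j + 2) ^ 2) + E + G)
            * (x ^ q / (q.factorial : ℝ)) := by ring
      _ ≤ _ := by gcongr

theorem exists_convPow_ne_zero_of_monomial {N : ℝ → ℝ} {a c G : ℝ} {k : ℕ}
    (hcont : ∀ j, Continuous (convPow N j)) (hG : 0 ≤ G) (ha : 0 < a) (hc : c ≠ 0)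
    (hN : ∀ x ∈ Icc 0 a, |N x - c * (x ^ k / (k.factorial : ℝ))|
      ≤ |c| * G * (x ^ (k + 2) / ((k + 2).factorial : ℝ))) :
    ∃ j, convPow N j a ≠ 0 := by
  by_contra! h
  obtain ⟨j, hj⟩ := exists_nat_gt (G * Real.exp (G * a ^ 2 * 2) * a ^ 2)
  have hb := abs_convPow_sub_monomial_le hcont hG hN j (x := a) ⟨ha.le, le_rfl⟩
  set n := (k + 1) * j + k with hn
  have hnj : (j : ℝ) ≤ n := by
    have : j ≤ n := by rw [hn]; nlinarith [Nat.zero_le (k * j)]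
    exact_mod_cast this
  have hn0 : (0 : ℝ) < n.factorial := by exact_mod_cast n.factorial_pos
  have hf : ((n + 2).factorial : ℝ) = (n + 2) * (n + 1) * n.factorial := by
    rw [Nat.factorial_succ, Nat.factorial_succ]; push_cast; ring
  have hcp : 0 < |c| ^ (j + 1) := by positivity
  have hpn : 0 < a ^ n / (n.factorial : ℝ) := by positivity
  rw [h, zero_sub, abs_neg, abs_mul, abs_pow, abs_of_pos hpn] at hb
  have e2 : a ^ (n + 2) / ((n + 2).factorial : ℝ)
      = (a ^ n / (n.factorial : ℝ)) * (a ^ 2 / ((n + 2) * (n + 1))) := by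
    rw [hf, pow_add]; field_simp
  have hlt : G * (j + 1) * Real.exp (G * a ^ 2 * (2 - 1 / (j + 1))) *
      (a ^ 2 / ((n + 2) * (n + 1))) < 1 := by
    have h1 : Real.exp (G * a ^ 2 * (2 - 1 / ((j : ℝ) + 1))) ≤ Real.exp (G * a ^ 2 * 2) := by
      gcongr
      have : 0 ≤ 1 / ((j : ℝ) + 1) := by positivity
      linarith
    calc _ ≤ G * (j + 1) * Real.exp (G * a ^ 2 * 2) * (a ^ 2 / ((j + 1) * (j + 1))) := by
          gcongr
          · linarith
      _ = (G * Real.exp (G * a ^ 2 * 2) * a ^ 2) / (j + 1) := by field_simp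
      _ < 1 := by rw [div_lt_one (by positivity)]; linarith
  rw [e2] at hb
  have : |c| ^ (j + 1) * (a ^ n / (n.factorial : ℝ)) * 1 ≤ |c| ^ (j + 1) * (a ^ n / (n.factorial : ℝ)) *
      (G * (j + 1) * Real.exp (G * a ^ 2 * (2 - 1 / (j + 1))) * (a ^ 2 / ((n + 2) * (n + 1)))) := by
    linarith
  have := le_of_mul_le_mul_left this (by positivity)
  linarith

theorem convPow_exp_mul (M : ℝ → ℝ) (b : ℝ) : ∀ (j : ℕ) (x : ℝ),
    convPow (fun y => Real.exp (b * y) * M y) j x = Real.exp (b * x) * convPow M j x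
  | 0, x => by simp [convPow]
  | 1, _ => rfl
  | (j+2), x => by
    rw [convPow, conv, convPow, conv, ← intervalIntegral.integral_const_mul]
    refine intervalIntegral.integral_congr fun s _ => ?_
    have h : Real.exp (b * x) = Real.exp (b * (x - s)) * Real.exp (b * s) := by
      rw [← Real.exp_add]; ring_nf
    simp only [convPow_exp_mul M b (j + 1) s, h]
    ring

open Filter Topology in
theorem exists_convPow_ne_zero {M : ℝ → ℝ} (hM : AnalyticOnNhd ℝ M univ)
    (hM0 : ¬∀ᶠ x in 𝓝 (0 : ℝ), M x = 0) {a : ℝ} (ha : 0 < a) : ∃ j, convPow M j a ≠ 0 := by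
  obtain ⟨k, g, hg, hg0, hMg⟩ :=
    (hM 0 (mem_univ 0)).exists_eventuallyEq_pow_smul_nonzero_iff.mpr hM0
  simp only [sub_zero, smul_eq_mul] at hMg
  set b := -deriv g 0 / g 0 with hb
  set N : ℝ → ℝ := fun y => Real.exp (b * y) * M y with hN
  have hNan : AnalyticOnNhd ℝ N univ := fun x hx => by
    have := hM x hx
    fun_prop
  suffices h : ∃ j, convPow N j a ≠ 0 by
    obtain ⟨j, hj⟩ := h
    rw [convPow_exp_mul] at hj
    exact ⟨j, right_ne_zero_of_mul hj⟩
  set h : ℝ → ℝ := fun y => Real.exp (b * y) * g y with hh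
  have han : AnalyticAt ℝ h 0 := by fun_prop
  have hder : HasDerivAt h 0 0 := by
    have h1 : HasDerivAt (fun y : ℝ => Real.exp (b * y)) (Real.exp (b * 0) * b) 0 := by
      simpa using ((hasDerivAt_id (0 : ℝ)).const_mul b).exp
    refine (h1.mul hg.differentiableAt.hasDerivAt).congr_deriv ?_
    rw [hb]
    simp
    field_simp
    ring
  obtain ⟨p, hp⟩ := han
  have hO := hp.isBigO_sub_partialSum_pow 2
  obtain ⟨C, hC⟩ := hO.bound
  have hps : ∀ y : ℝ, p.partialSum 2 y = g 0 := by
    intro y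
    have e1 := hp.deriv
    rw [hder.deriv] at e1
    have e2 : p.coeff 1 = 0 := e1.symm
    have e0 : p.coeff 0 = g 0 := by
      simpa [hh] using hp.coeff_zero 1
    simp [FormalMultilinearSeries.partialSum, Finset.sum_range_succ, e0, e2]
  have hloc : ∀ᶠ x in 𝓝 (0 : ℝ), |N x - g 0 * x ^ k| ≤ C * |x| ^ 2 * |x| ^ k := by
    filter_upwards [hC, hMg] with x hx hxM
    rw [hps, zero_add] at hx
    have e : N x - g 0 * x ^ k = (h x - g 0) * x ^ k := by
      simp only [hN, hh, hxM]; ring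
    rw [e, abs_mul, abs_pow]
    gcongr
    simpa using hx
  obtain ⟨δ, hδ, hδloc⟩ := Metric.eventually_nhds_iff.mp hloc
  have hcont := fun j => continuous_convPow hNan j
  have hNc : Continuous N := hcont 1
  obtain ⟨B, hB⟩ := (isCompact_Icc (a := (0 : ℝ)) (b := a)).exists_bound_of_continuousOn
    (f := fun x => N x - g 0 * x ^ k) (by fun_prop)
  have hB0 : 0 ≤ B := (norm_nonneg _).trans (hB 0 ⟨le_rfl, ha.le⟩)
  set D := max C (B / δ ^ (k + 2)) with hD
  have hD0 : 0 ≤ D := le_max_of_le_right (by positivity)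
  have hglob : ∀ x ∈ Icc 0 a, |N x - g 0 * x ^ k| ≤ D * x ^ (k + 2) := by
    intro x hx
    have hx0 := hx.1
    rcases lt_or_ge x δ with hxδ | hxδ
    · have := hδloc (y := x) (by simpa [abs_of_nonneg hx0] using hxδ)
      rw [abs_of_nonneg hx0] at this
      refine this.trans ?_
      calc C * x ^ 2 * x ^ k = C * x ^ (k + 2) := by ring
        _ ≤ D * x ^ (k + 2) := by
          gcongr
          exact le_max_left _ _
    · calc |N x - g 0 * x ^ k| ≤ B := hB x hx
        _ = B / δ ^ (k + 2) * δ ^ (k + 2) := by field_simp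
        _ ≤ D * x ^ (k + 2) := by
          gcongr
          exact le_max_right _ _
  have hk0 : (0 : ℝ) < k.factorial := by exact_mod_cast k.factorial_pos
  have hk2 : (0 : ℝ) < (k + 2).factorial := by exact_mod_cast (k + 2).factorial_pos
  refine exists_convPow_ne_zero_of_monomial (k := k) (c := g 0 * k.factorial)
    (G := D * (k + 2).factorial / |g 0 * k.factorial|) hcont (by positivity) ha
    (by positivity) fun x hx => ?_
  have e1 : g 0 * k.factorial * (x ^ k / k.factorial) = g 0 * x ^ k := by field_simp
  have hc : 0 < |g 0 * (k.factorial : ℝ)| := by positivity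
  rw [e1]
  refine (hglob x hx).trans_eq ?_
  field_simp

theorem eq_zero_of_tsum_pow_eq_zero {c : ℕ → ℝ} {D : ℝ} (hc : ∀ j, |c j| ≤ D ^ j)
    (h : ∀ y : ℝ, ∑' j : ℕ, (y ^ j / (j.factorial : ℝ)) * c j = 0) (j : ℕ) : c j = 0 := by
  set p : FormalMultilinearSeries ℝ ℝ ℝ :=
    FormalMultilinearSeries.ofScalars ℝ (fun n => c n / (n.factorial : ℝ)) with hp
  have hrad : p.radius = ⊤ := by
    refine p.radius_eq_top_of_summable_norm fun r => ?_
    refine Summable.of_nonneg_of_le (fun n => by positivity) (fun n => ?_)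
      (Real.summable_pow_div_factorial (D * r))
    rw [hp, FormalMultilinearSeries.ofScalars_norm, norm_div, Real.norm_natCast, mul_pow,
      div_mul_eq_mul_div]
    gcongr
    exact hc n
  have hps := (p.hasFPowerSeriesOnBall (by rw [hrad]; simp)).hasFPowerSeriesAt
  have hs : p.sum = 0 := by
    ext y
    rw [Pi.zero_apply, ← h y, FormalMultilinearSeries.sum]
    refine tsum_congr fun n => ?_
    simp [hp]
    ring
  rw [hs] at hps
  have h0 := hps.eq_zero
  have h1 : p.coeff j = 0 := by rw [h0]; rfl
  rw [hp, FormalMultilinearSeries.coeff_ofScalars] at h1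
  simpa [j.factorial_ne_zero] using h1

open Filter Topology in
theorem exists_tsum_affine_ne_zero {M : ℝ → ℝ} (hM : AnalyticOnNhd ℝ M univ)
    (hM0 : ¬∀ᶠ x in 𝓝 (0 : ℝ), M x = 0) {p q : ℝ} (hpq : p ≠ 0 ∨ q ≠ 0) :
    ∃ x, ∑' j : ℕ, ((-(p + q * x)) ^ j / (j.factorial : ℝ)) * convPow M j x ≠ 0 := by
  by_contra! hzero
  obtain ⟨k, g, hg, hg0, hMg⟩ :=
    (hM 0 (mem_univ 0)).exists_eventuallyEq_pow_smul_nonzero_iff.mpr hM0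
  simp only [sub_zero, smul_eq_mul] at hMg
  have hgpos : 0 < |g 0| := abs_pos.mpr hg0
  have hgc : Tendsto (fun x => |g x|) (𝓝 0) (𝓝 |g 0|) := hg.continuousAt.abs.tendsto
  have hup : ∀ᶠ x in 𝓝 (0 : ℝ), |g x| < 2 * |g 0| := hgc.eventually_lt_const (by linarith)
  have hlo : ∀ᶠ x in 𝓝 (0 : ℝ), |g 0| / 2 < |g x| := hgc.eventually_const_lt (by linarith)
  obtain ⟨T, hT, hTall⟩ := Metric.eventually_nhds_iff.mp (hMg.and (hup.and hlo))
  set A := 2 * |g 0| with hA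
  have hA0 : 0 ≤ A := by positivity
  clear_value A
  set S := |p| + |q| with hS
  have hS0 : 0 ≤ S := by positivity
  set C := S * A ^ 2 * Real.exp (S * A) with hC
  have hC0 : 0 ≤ C := by positivity
  have hsne : ∀ᶠ x in 𝓝[>] (0 : ℝ), p + q * x ≠ 0 := by
    by_cases hp : p = 0
    · have hq : q ≠ 0 := hpq.resolve_left (not_not.mpr hp)
      filter_upwards [self_mem_nhdsWithin] with x hx
      rw [hp, zero_add]
      exact mul_ne_zero hq (ne_of_gt hx)
    · have hc : ContinuousAt (fun x : ℝ => p + q * x) 0 := by fun_prop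
      exact nhdsWithin_le_nhds (hc.eventually_ne (by simpa using hp))
  have hsmall : ∀ᶠ x in 𝓝[>] (0 : ℝ), x < 1 ∧ x < T ∧ C * x < |g 0| / 2 := by
    have h1 : ∀ᶠ x in 𝓝 (0 : ℝ), x < 1 := eventually_lt_nhds one_pos
    have h2 : ∀ᶠ x in 𝓝 (0 : ℝ), x < T := eventually_lt_nhds hT
    have hc : ContinuousAt (fun x : ℝ => C * x) 0 := by fun_prop
    have h3 : ∀ᶠ x in 𝓝 (0 : ℝ), C * x < |g 0| / 2 :=
      hc.tendsto.eventually_lt_const (by simpa using hg0)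
    exact nhdsWithin_le_nhds (h1.and (h2.and h3))
  obtain ⟨x, ⟨hsx, hx1, hxT, hxC⟩, hx0⟩ :=
    ((hsne.and hsmall).and self_mem_nhdsWithin).exists
  replace hx0 : 0 < x := hx0
  have hup' : ∀ y ∈ Icc 0 x, |M y| ≤ A * y ^ k := by
    intro y hy
    obtain ⟨h1, h2, -⟩ := hTall (y := y) (by
      rw [Real.dist_eq, sub_zero, abs_of_nonneg hy.1]; linarith [hy.2])
    rw [h1, abs_mul, abs_pow, abs_of_nonneg hy.1, mul_comm]
    gcongr
    exact pow_nonneg hy.1 _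
  have hlo' : |g 0| / 2 * x ^ k ≤ |M x| := by
    obtain ⟨h1, -, h3⟩ := hTall (y := x) (by
      rwa [Real.dist_eq, sub_zero, abs_of_pos hx0])
    rw [h1, abs_mul, abs_pow, abs_of_pos hx0, mul_comm]
    gcongr
  set s := p + q * x with hs
  have hsS : |s| ≤ S := by
    refine (abs_add_le _ _).trans ?_
    rw [abs_mul, abs_of_pos hx0]
    have : |q| * x ≤ |q| * 1 := by gcongr
    linarith
  set f : ℕ → ℝ := fun j => ((-s) ^ j / (j.factorial : ℝ)) * convPow M j x with hf
  have htail : ∀ j, ‖f (j + 2)‖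
      ≤ |s| * S * A ^ 2 * x ^ (2 * k + 1) * ((S * A) ^ j / (j.factorial : ℝ)) := by
    intro j
    have hb := abs_convPow_le hA0 hup' (j + 1) (x := x) ⟨hx0.le, le_rfl⟩
    have hpw : x ^ ((k + 1) * (j + 1) + k) ≤ x ^ (2 * k + 1) :=
      pow_le_pow_of_le_one hx0.le hx1.le (by nlinarith [Nat.zero_le (k * j)])
    have hfac : (j.factorial : ℝ) ≤ (j + 2).factorial := by
      exact_mod_cast Nat.factorial_le (by omega)
    have hj0 : (0 : ℝ) < j.factorial := by exact_mod_cast j.factorial_pos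
    rw [hf, Real.norm_eq_abs, abs_mul, abs_div, abs_pow, abs_neg, Nat.abs_cast]
    calc |s| ^ (j + 2) / ((j + 2).factorial : ℝ) * |convPow M (j + 1 + 1) x|
        ≤ (|s| * S ^ (j + 1)) / (j.factorial : ℝ) * (A ^ (j + 2) * x ^ (2 * k + 1)) := by
          gcongr
          · rw [pow_succ' |s|]
            gcongr
          · exact hb.trans (by gcongr)
      _ = _ := by rw [mul_pow]; ring
  have hsum2 := (Real.summable_pow_div_factorial (S * A)).mul_left
    (|s| * S * A ^ 2 * x ^ (2 * k + 1))
  have hsf2 : Summable fun j => f (j + 2) := Summable.of_norm_bounded hsum2 htail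
  have hsf : Summable f := (summable_nat_add_iff 2).mp hsf2
  have hsplit := hsf.sum_add_tsum_nat_add 2
  have hexp : ∑' j : ℕ, (S * A) ^ j / (j.factorial : ℝ) = Real.exp (S * A) := by
    rw [Real.exp_eq_exp_ℝ, NormedSpace.exp_eq_tsum_div]
  have hbound : |∑' j, f (j + 2)| ≤ |s| * (C * x ^ (2 * k + 1)) := by
    refine (tsum_of_norm_bounded hsum2.hasSum htail).trans_eq ?_
    rw [tsum_mul_left, hexp, hC]
    ring
  rw [hzero x] at hsplit
  have hf01 : ∑ j ∈ Finset.range 2, f j = -s * M x := by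
    simp [Finset.sum_range_succ, hf, convPow]
  rw [hf01] at hsplit
  have heq : ∑' j, f (j + 2) = s * M x := by linarith
  rw [heq, abs_mul] at hbound
  have h1 : |M x| ≤ C * x ^ (2 * k + 1) := le_of_mul_le_mul_left hbound (abs_pos.mpr hsx)
  have h2 : C * x ^ (2 * k + 1) ≤ C * x * x ^ k := by
    calc C * x ^ (2 * k + 1) = C * x * x ^ k * x ^ k := by ring
      _ ≤ C * x * x ^ k * 1 := by
        gcongr
        exact pow_le_one₀ hx0.le hx1.le
      _ = _ := by ring
  have h3 : C * x * x ^ k < |g 0| / 2 * x ^ k := by gcongr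
  linarith

/-- strong non-degeneracy of the flow kernel.  Suppose `M` is real analytic
on `ℝ` and not identically zero on `[0,∞)`.  For any `(t₀,s₀)` with `t₀ ≥ s₀` and any unit
vector `(v₁,v₂)` such that `(t₀,s₀,v₁,v₂)` is not in the exceptional set
`I = {(t,t,τ,τ) : τ = ±1/√2} ∪ {(t,0,τ,0) : t ≥ 0, τ = ±1}`, some directional derivative
`∂_{(v₁,v₂)}^l K_M(t₀,s₀)` is nonzero. -/
theorem KM_strong_unique_continuation
    (M : ℝ → ℝ) (hM : AnalyticOnNhd ℝ M Set.univ)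
    (hM0 : ∃ t : ℝ, 0 ≤ t ∧ M t ≠ 0)
    (t₀ s₀ v₁ v₂ : ℝ) (hts : s₀ ≤ t₀) (hv : v₁ ^ 2 + v₂ ^ 2 = 1)
    (hI : ¬ ((t₀ = s₀ ∧ v₁ = v₂ ∧ (v₁ = 1 / Real.sqrt 2 ∨ v₁ = -(1 / Real.sqrt 2))) ∨
        (0 ≤ t₀ ∧ s₀ = 0 ∧ v₂ = 0 ∧ (v₁ = 1 ∨ v₁ = -1)))) :
    ∃ l : ℕ, iteratedDeriv l (fun r : ℝ => KM M (t₀ + r * v₁) (s₀ + r * v₂)) 0 ≠ 0 := by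
  by_contra! h0
  have hline := KM_line_eq_zero hM h0
  have hM0' : ¬∀ᶠ x in nhds (0 : ℝ), M x = 0 := by
    intro h
    obtain ⟨t, -, ht⟩ := hM0
    exact ht (hM.eqOn_zero_of_preconnected_of_eventuallyEq_zero isPreconnected_univ
      (mem_univ 0) h (mem_univ t))
  by_cases hb : v₁ = v₂
  · subst hb
    have hv1 : v₁ ^ 2 = 1 / 2 := by linarith
    have hv0 : v₁ ≠ 0 := by
      rintro rfl
      norm_num at hv1
    have hlt : s₀ < t₀ := by
      refine lt_of_le_of_ne hts fun he => hI (Or.inl ⟨he.symm, rfl, ?_⟩)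
      rw [← sq_eq_sq_iff_eq_or_eq_neg, hv1, div_pow, Real.sq_sqrt (by norm_num), one_pow]
    obtain ⟨j, hj⟩ := exists_convPow_ne_zero hM hM0' (sub_pos.mpr hlt)
    refine hj ?_
    have hMc : Continuous M := continuous_convPow hM 1
    obtain ⟨A, hA⟩ := (isCompact_Icc (a := (0 : ℝ)) (b := t₀ - s₀)).exists_bound_of_continuousOn
      hMc.continuousOn
    have ha0 : 0 ≤ t₀ - s₀ := by linarith
    have hA0 : 0 ≤ A := (norm_nonneg _).trans (hA 0 ⟨le_rfl, ha0⟩)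
    refine eq_zero_of_tsum_pow_eq_zero (c := fun j => convPow M j (t₀ - s₀))
      (D := A * max 1 (t₀ - s₀)) (fun j => ?_) (fun y => ?_) j
    · cases j with
      | zero => simp [convPow]
      | succ j =>
        have h := abs_convPow_le (k := 0) hA0 (fun x hx => by simpa using hA x hx) j
          (x := t₀ - s₀) ⟨ha0, le_rfl⟩
        refine h.trans ?_
        rw [mul_pow]
        gcongr
        calc (t₀ - s₀) ^ ((0 + 1) * j + 0) ≤ (max 1 (t₀ - s₀)) ^ j := by
              simp only [zero_add, one_mul, add_zero]
              gcongr
              exact le_max_right _ _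
          _ ≤ (max 1 (t₀ - s₀)) ^ (j + 1) := pow_le_pow_right₀ (le_max_left _ _) j.le_succ
    · have h := hline ((-y - s₀) / v₁)
      rw [KM, div_mul_cancel₀ _ hv0] at h
      have e : t₀ + (-y - s₀) - -y = t₀ - s₀ := by ring
      simpa only [add_sub_cancel, neg_neg, e] using h
  · have hb' : v₁ - v₂ ≠ 0 := sub_ne_zero.mpr hb
    have hpq : s₀ - (t₀ - s₀) * (v₂ / (v₁ - v₂)) ≠ 0 ∨ v₂ / (v₁ - v₂) ≠ 0 := by
      by_contra! hc
      obtain ⟨hp, hq⟩ := hc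
      have hv2 : v₂ = 0 := (div_eq_zero_iff.mp hq).resolve_right hb'
      have hs0 : s₀ = 0 := by simpa [hq] using hp
      refine hI (Or.inr ⟨hs0 ▸ hts, hs0, hv2, ?_⟩)
      rw [← sq_eq_sq_iff_eq_or_eq_neg]
      simpa [hv2] using hv
    obtain ⟨x, hx⟩ := exists_tsum_affine_ne_zero hM hM0' hpq
    refine hx ?_
    have h := hline ((x - (t₀ - s₀)) / (v₁ - v₂))
    rw [KM] at h
    have e1 : s₀ - (t₀ - s₀) * (v₂ / (v₁ - v₂)) + v₂ / (v₁ - v₂) * x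
        = s₀ + (x - (t₀ - s₀)) / (v₁ - v₂) * v₂ := by field_simp; ring
    have e2 : t₀ + (x - (t₀ - s₀)) / (v₁ - v₂) * v₁ - (s₀ + (x - (t₀ - s₀)) / (v₁ - v₂) * v₂)
        = x := by field_simp; ring
    rw [e2] at h
    rw [e1]
    exact h
end

section
/- Let M ∈ C^∞([0,∞), ℝ) and let K_M(t,s) := ∑_{j=1}^∞ ((-s)^j / j!) M^{*j}(t-s) be the associated flow kernel. Then for every integer l ≥ 0 and every t ≥ 0, the l-th derivative of the map s ↦ K_M(t,s) satisfies ∂_s^l K_M(t,s)|_{s=0} = h_l(t) and ∂_s^l K_M(t,s)|_{s=t} = −p_l(t), where at s = t the derivative is taken from the left. -/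
open Set MeasureTheory

/-- The coefficient `h_l(t) = (-1)^l ∑_{j=0}^l C(l, l-j) (d^{l-j}/dt^{l-j} M^{*j})(t)`
(derivatives taken within `[0,∞)`; recall the convention `M^{*0} = 0`). -/
noncomputable def hcoef (M : ℝ → ℝ) (l : ℕ) (t : ℝ) : ℝ :=
  (-1 : ℝ) ^ l * ∑ j ∈ Finset.range (l + 1),
    (l.choose (l - j) : ℝ) * iteratedDerivWithin (l - j) (convPow M j) (Set.Ici 0) t

/-- The coefficient
`p_l(t) = −h_l(0) + (-1)^{l+1} ∑_{(m,j)} C(l, l-j+m) ((d^{l-j+m}/dt^{l-j+m}) M^{*j})(0) (-t)^m/m!`,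
where the sum runs over pairs of positive integers `(m,j)` with `2j − l − 1 ≤ m ≤ j`
(equivalently `2j ≤ m + l + 1`; all such pairs satisfy `m ≤ j ≤ l + 1`, and the exponent
`l - j + m` is the natural number `l + m - j ≥ 0`). -/
noncomputable def pcoef (M : ℝ → ℝ) (l : ℕ) (t : ℝ) : ℝ :=
  -hcoef M l 0 + (-1 : ℝ) ^ (l + 1) *
    ∑ j ∈ Finset.Icc 1 (l + 1), ∑ m ∈ Finset.Icc 1 j,
      if 2 * j ≤ m + l + 1 then
        (l.choose (l + m - j) : ℝ) *
          iteratedDerivWithin (l + m - j) (convPow M j) (Set.Ici 0) 0 *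
          ((-t) ^ m / (m.factorial : ℝ))
      else 0

open Filter Topology in
lemma hasDerivAt_conv {f g : ℝ → ℝ} (hf : ContDiff ℝ 1 f) (hg : Continuous g) (t : ℝ) :
    HasDerivAt (conv f g) (f 0 * g t + conv (deriv f) g t) t := by
  have hfc : Continuous f := hf.continuous
  have hf' : Continuous (deriv f) := hf.continuous_deriv le_rfl
  have hfd : Differentiable ℝ f := hf.differentiable one_ne_zero
  let F : ℝ → ℝ → ℝ := fun a b => ∫ s in (0:ℝ)..a, f (b - s) * g s
  let F₁ : ℝ → ℝ → ℝ →L[ℝ] ℝ := fun a b => ContinuousLinearMap.toSpanSingleton ℝ (f (b - a) * g a)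
  let F₂ : ℝ → ℝ → ℝ →L[ℝ] ℝ := fun a b =>
    ContinuousLinearMap.toSpanSingleton ℝ (∫ s in (0:ℝ)..a, deriv f (b - s) * g s)
  have h1 : ∀ a b, HasDerivAt (fun a => F a b) (f (b - a) * g a) a := fun a b => by
    have hc : Continuous fun s => f (b - s) * g s := by fun_prop
    exact hc.integral_hasStrictDerivAt 0 a |>.hasDerivAt
  have h2 : ∀ a b, HasDerivAt (fun b => F a b) (∫ s in (0:ℝ)..a, deriv f (b - s) * g s) b := by
    intro a b
    have hc : Continuous fun p : ℝ × ℝ => deriv f (p.1 - p.2) * g p.2 := by fun_prop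
    obtain ⟨C, hC⟩ := ((isCompact_closedBall b 1).prod
      (isCompact_uIcc (a := 0) (b := a))).exists_bound_of_continuousOn hc.continuousOn
    refine (intervalIntegral.hasDerivAt_integral_of_dominated_loc_of_deriv_le
      (F := fun b s => f (b - s) * g s) (F' := fun b s => deriv f (b - s) * g s)
      (bound := fun _ => C) (Metric.closedBall_mem_nhds b one_pos) ?_ ?_ ?_ ?_ ?_ ?_).2
    · exact Eventually.of_forall fun x => Continuous.aestronglyMeasurable (by fun_prop)
    · exact Continuous.intervalIntegrable (by fun_prop) _ _
    · exact Continuous.aestronglyMeasurable (by fun_prop)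
    · exact Eventually.of_forall fun s hs x hx => hC (x, s) ⟨hx, Set.uIoc_subset_uIcc hs⟩
    · exact intervalIntegrable_const
    · refine Eventually.of_forall fun s _ x _ => ?_
      exact ((hfd (x - s)).hasDerivAt.comp_sub_const x s).mul_const _
  have key := hasStrictFDerivAt_uncurry_coprod (u := (t, t)) (f := F) (f₁ := F₁) (f₂ := F₂)
    (Eventually.of_forall fun v => (h1 v.1 v.2).hasFDerivAt)
    (Eventually.of_forall fun v => (h2 v.1 v.2).hasFDerivAt)
    (by
      apply Continuous.continuousAt
      change Continuous fun p : ℝ × ℝ =>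
        ContinuousLinearMap.toSpanSingletonCLE (𝕜 := ℝ) (f (p.2 - p.1) * g p.1)
      fun_prop)
    (by
      apply Continuous.continuousAt
      change Continuous fun p : ℝ × ℝ => ContinuousLinearMap.toSpanSingletonCLE (𝕜 := ℝ)
        (∫ s in (0:ℝ)..p.1, deriv f (p.2 - s) * g s)
      fun_prop)
  have hd := key.hasFDerivAt.comp_hasDerivAt_of_eq t
    ((hasDerivAt_id t).prodMk (hasDerivAt_id t)) rfl
  have hval : ((↿F₁ (t, t)).coprod (↿F₂ (t, t))) (1, 1) = f 0 * g t + conv (deriv f) g t := by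
    simp [F₁, F₂, conv, Function.HasUncurry.uncurry]
  rw [hval] at hd
  exact hd

lemma continuous_conv {f g : ℝ → ℝ} (hf : Continuous f) (hg : Continuous g) :
    Continuous (conv f g) := by
  unfold conv
  fun_prop

lemma deriv_conv {f g : ℝ → ℝ} (hf : ContDiff ℝ 1 f) (hg : Continuous g) :
    deriv (conv f g) = (fun t => f 0 * g t) + conv (deriv f) g :=
  funext fun t => (hasDerivAt_conv hf hg t).deriv

lemma contDiff_conv {n : ℕ} {f g : ℝ → ℝ} (hf : ContDiff ℝ n f) (hg : ContDiff ℝ n g) :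
    ContDiff ℝ n (conv f g) := by
  induction n generalizing f with
  | zero =>
    simp only [Nat.cast_zero, contDiff_zero] at *
    exact continuous_conv hf hg
  | succ n ih =>
    have hf1 : ContDiff ℝ 1 f := hf.of_le (by exact_mod_cast Nat.le_add_left 1 n)
    have hgn : ContDiff ℝ n g := hg.of_le (by exact_mod_cast n.le_succ)
    push_cast at hf ⊢
    refine contDiff_succ_iff_deriv.2
      ⟨fun t => (hasDerivAt_conv hf1 hg.continuous t).differentiableAt, by simp, ?_⟩
    rw [deriv_conv hf1 hg.continuous]
    exact (contDiff_const.mul hgn).add (ih (contDiff_succ_iff_deriv.1 hf).2.2 hgn)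

lemma iteratedDeriv_succ_conv {n : ℕ} {f g : ℝ → ℝ} (hf : ContDiff ℝ (n + 1) f)
    (hg : ContDiff ℝ n g) (t : ℝ) :
    iteratedDeriv (n + 1) (conv f g) t =
      f 0 * iteratedDeriv n g t + iteratedDeriv n (conv (deriv f) g) t := by
  have hf1 : ContDiff ℝ 1 f := hf.of_le (by exact_mod_cast Nat.le_add_left 1 n)
  rw [iteratedDeriv_succ', deriv_conv hf1 hg.continuous, iteratedDeriv_add,
    iteratedDeriv_const_mul_field]
  · exact (contDiff_const.mul hg).contDiffAt
  · exact (contDiff_conv (contDiff_succ_iff_deriv.1 hf).2.2 hg).contDiffAt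

lemma iteratedDeriv_conv_zero {n : ℕ} {f g : ℝ → ℝ} (hf : ContDiff ℝ n f) (hg : ContDiff ℝ n g)
    (h0 : ∀ i < n, iteratedDeriv i g 0 = 0) : iteratedDeriv n (conv f g) 0 = 0 := by
  induction n generalizing f with
  | zero => simp [conv]
  | succ n ih =>
    have hgn : ContDiff ℝ n g := hg.of_le (by exact_mod_cast n.le_succ)
    push_cast at hf
    rw [iteratedDeriv_succ_conv hf hgn, h0 n n.lt_succ_self,
      ih (contDiff_succ_iff_deriv.1 hf).2.2 hgn fun i hi => h0 i (hi.trans n.lt_succ_self)]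
    simp

lemma exists_bound_conv {f : ℝ → ℝ} (hf : Continuous f) (T : ℝ) :
    ∃ A, 0 ≤ A ∧ ∀ (g : ℝ → ℝ) (B : ℝ),
      (∀ x ∈ Icc (-T) T, |g x| ≤ B) → ∀ x ∈ Icc (-T) T, |conv f g x| ≤ A * B := by
  obtain ⟨C, hC⟩ := isCompact_Icc.exists_bound_of_continuousOn
    (s := Icc (-T) T) hf.continuousOn
  refine ⟨|C| * |T|, by positivity, fun g B hB x hx => ?_⟩
  have hB0 : 0 ≤ B := (abs_nonneg _).trans (hB x hx)
  have h := intervalIntegral.norm_integral_le_of_norm_le_const (a := 0) (b := x)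
    (f := fun s => f (x - s) * g s) (C := |C| * B) fun s hs => by
      rw [norm_mul]
      have hs' : s ∈ Icc (-T) T ∧ x - s ∈ Icc (-T) T := by
        rcases mem_uIoc.1 hs with hs | hs <;>
          refine ⟨⟨?_, ?_⟩, ⟨?_, ?_⟩⟩ <;> linarith [hs.1, hs.2, hx.1, hx.2]
      exact mul_le_mul ((hC _ hs'.2).trans (le_abs_self C)) (hB s hs'.1) (abs_nonneg _)
        (abs_nonneg _)
  refine h.trans ?_
  have hxT : |x - 0| ≤ |T| := by
    rw [sub_zero]
    exact (abs_le.2 hx).trans (le_abs_self T)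
  calc |C| * B * |x - 0| ≤ |C| * B * |T| := by gcongr
    _ = |C| * |T| * B := by ring

lemma exists_bound_iteratedDeriv_conv {n : ℕ} {f : ℝ → ℝ} (hf : ContDiff ℝ n f) (T : ℝ) :
    ∃ A, 0 ≤ A ∧ ∀ (g : ℝ → ℝ) (B : ℝ), ContDiff ℝ n g →
      (∀ i ≤ n, ∀ x ∈ Icc (-T) T, |iteratedDeriv i g x| ≤ B) →
      ∀ i ≤ n, ∀ x ∈ Icc (-T) T, |iteratedDeriv i (conv f g) x| ≤ A * B := by
  induction n generalizing f with
  | zero =>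
    obtain ⟨A, hA, hb⟩ := exists_bound_conv hf.continuous T
    refine ⟨A, hA, fun g B _ hB i hi x hx => ?_⟩
    obtain rfl : i = 0 := by omega
    simpa using hb g B (fun y hy => by simpa using hB 0 le_rfl y hy) x hx
  | succ n ih =>
    obtain ⟨A₀, hA₀, hb⟩ := exists_bound_conv hf.continuous T
    push_cast at hf
    obtain ⟨A, hA, hb'⟩ := ih (contDiff_succ_iff_deriv.1 hf).2.2
    refine ⟨A₀ + |f 0| + A, by positivity, fun g B hg hB i hi x hx => ?_⟩
    have hB0 : 0 ≤ B := (abs_nonneg _).trans (hB 0 (Nat.zero_le _) x hx)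
    have hgn : ContDiff ℝ n g := hg.of_le (by exact_mod_cast n.le_succ)
    rcases i with _ | i
    · have h := hb g B (fun y hy => by simpa using hB 0 (Nat.zero_le _) y hy) x hx
      rw [iteratedDeriv_zero]
      nlinarith [mul_nonneg (abs_nonneg (f 0)) hB0, mul_nonneg hA hB0]
    · have hin : i ≤ n := by omega
      rw [iteratedDeriv_succ_conv (hf.of_le (by gcongr)) (hgn.of_le (by exact_mod_cast hin))]
      have h₁ := hb' g B hgn (fun k hk => hB k (by omega)) i hin x hx
      have h₂ : |f 0| * |iteratedDeriv i g x| ≤ |f 0| * B :=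
        mul_le_mul_of_nonneg_left (hB i (by omega) x hx) (abs_nonneg _)
      have h₃ := abs_add_le (f 0 * iteratedDeriv i g x) (iteratedDeriv i (conv (deriv f) g) x)
      rw [abs_mul] at h₃
      nlinarith [mul_nonneg hA₀ hB0]

lemma contDiff_convPow {n : ℕ} {M : ℝ → ℝ} (hM : ContDiff ℝ n M) :
    ∀ j, ContDiff ℝ n (convPow M j)
  | 0 => contDiff_const
  | 1 => hM
  | (j + 2) => contDiff_conv hM (contDiff_convPow hM (j + 1))

lemma iteratedDeriv_convPow_zero {M : ℝ → ℝ} (j : ℕ) :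
    ∀ {k : ℕ}, ContDiff ℝ k M → k + 2 ≤ j → iteratedDeriv k (convPow M j) 0 = 0 := by
  induction j with
  | zero => intro k _ h; omega
  | succ j ih =>
    intro k hM h
    obtain ⟨j, rfl⟩ : ∃ i, j = i + 1 := ⟨j - 1, by omega⟩
    exact iteratedDeriv_conv_zero hM (contDiff_convPow hM _) fun i hi =>
      ih (hM.of_le (by exact_mod_cast hi.le)) (by omega)

lemma exists_bound_iteratedDeriv_convPow {n : ℕ} {M : ℝ → ℝ} (hM : ContDiff ℝ n M) (T : ℝ) :
    ∃ A B, 0 ≤ A ∧ 0 ≤ B ∧ ∀ j, ∀ i ≤ n, ∀ x ∈ Icc (-T) T,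
      |iteratedDeriv i (convPow M j) x| ≤ A ^ j * B := by
  obtain ⟨A, hA, h⟩ := exists_bound_iteratedDeriv_conv hM T
  have hM' : ∀ i : ℕ, ∃ C, i ≤ n → ∀ x ∈ Icc (-T) T, |iteratedDeriv i M x| ≤ C := by
    intro i
    by_cases hi : i ≤ n
    · obtain ⟨C, hC⟩ := isCompact_Icc.exists_bound_of_continuousOn (s := Icc (-T) T)
        (hM.continuous_iteratedDeriv i (by exact_mod_cast hi)).continuousOn
      exact ⟨C, fun _ => hC⟩
    · exact ⟨0, fun h => absurd h hi⟩
  choose C hC using hM'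
  have hB : 0 ≤ ∑ i ∈ Finset.range (n + 1), |C i| := by positivity
  refine ⟨A + 1, ∑ i ∈ Finset.range (n + 1), |C i|, by positivity, hB, fun j => ?_⟩
  induction j with
  | zero =>
    intro i _ x _
    have : iteratedDeriv i (convPow M 0) x = 0 := by simp [convPow]
    rw [this]
    simpa using hB
  | succ j ih =>
    rcases j with _ | j
    · intro i hi x hx
      have h₁ : |C i| ≤ ∑ i ∈ Finset.range (n + 1), |C i| :=
        Finset.single_le_sum (f := fun i => |C i|) (fun _ _ => abs_nonneg _)
          (Finset.mem_range.2 (by omega))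
      have h₂ : |iteratedDeriv i M x| ≤ _ := (hC i hi x hx).trans ((le_abs_self _).trans h₁)
      refine h₂.trans ?_
      simp only [zero_add, pow_one]
      nlinarith
    · intro i hi x hx
      refine (h _ _ (contDiff_convPow hM (j + 1)) ih i hi x hx).trans ?_
      rw [pow_succ' _ (j + 1)]
      have : 0 ≤ (A + 1) ^ (j + 1) * ∑ i ∈ Finset.range (n + 1), |C i| := by positivity
      nlinarith

lemma convPow_congr {M N : ℝ → ℝ} (h : EqOn M N (Ici 0)) :
    ∀ j, EqOn (convPow M j) (convPow N j) (Ici 0)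
  | 0 => fun _ _ => rfl
  | 1 => h
  | (j + 2) => fun t ht => by
    refine intervalIntegral.integral_congr fun s hs => ?_
    rw [uIcc_of_le ht] at hs
    simp only [h (show t - s ∈ Ici 0 from sub_nonneg.2 hs.2), convPow_congr h (j + 1) hs.1]

lemma exists_contDiff_eqOn_Ici {n : ℕ} {f : ℝ → ℝ} (hf : ContDiffOn ℝ n f (Ici 0)) :
    ∃ g, ContDiff ℝ n g ∧ EqOn f g (Ici 0) := by
  induction n generalizing f with
  | zero =>
    refine ⟨fun x => f (max x 0), ?_, fun x hx => by simp [max_eq_left (mem_Ici.1 hx)]⟩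
    simp only [Nat.cast_zero, contDiff_zero, contDiffOn_zero] at *
    exact hf.comp_continuous (by fun_prop) fun x => le_max_right x 0
  | succ n ih =>
    push_cast at hf ⊢
    obtain ⟨hd, -, hf'⟩ := (contDiffOn_succ_iff_derivWithin (uniqueDiffOn_Ici 0)).1 hf
    obtain ⟨g, hg, hfg⟩ := ih hf'
    have hG : ∀ x, HasDerivAt (fun x => f 0 + ∫ s in (0:ℝ)..x, g s) (g x) x := fun x =>
      (hg.continuous.integral_hasStrictDerivAt 0 x).hasDerivAt.const_add _
    refine ⟨fun x => f 0 + ∫ s in (0:ℝ)..x, g s, ?_, fun x hx => ?_⟩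
    · refine contDiff_succ_iff_deriv.2 ⟨fun x => (hG x).differentiableAt, by simp, ?_⟩
      rwa [funext fun x => (hG x).deriv]
    · have hx0 : (0:ℝ) ≤ x := hx
      have := intervalIntegral.integral_eq_sub_of_hasDeriv_right_of_le hx0
        (hd.continuousOn.mono Icc_subset_Ici_self) (f' := g) (fun y hy => ?_)
        (hg.continuous.intervalIntegrable _ _)
      · simp [this]
      · have hy' : y ∈ Ici (0:ℝ) := hy.1.le
        rw [← hfg hy']
        exact (hd y hy').hasDerivWithinAt.mono fun z hz => hy.1.le.trans (le_of_lt hz)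

lemma contDiffOn_and_iteratedDeriv_eq {n : ℕ} {U : Set ℝ} (hU : IsOpen U) {S : ℕ → ℝ → ℝ}
    (hS : ∀ k ≤ n, ∀ x ∈ U, HasDerivAt (S k) (S (k + 1) x) x) :
    ContDiffOn ℝ n (S 0) U ∧ EqOn (iteratedDeriv n (S 0)) (S n) U := by
  induction n generalizing S with
  | zero =>
    simp only [Nat.cast_zero, contDiffOn_zero, iteratedDeriv_zero]
    exact ⟨fun x hx => (hS 0 le_rfl x hx).continuousAt.continuousWithinAt, fun _ _ => rfl⟩
  | succ n ih =>
    obtain ⟨h₁, h₂⟩ := ih (S := fun k => S (k + 1)) fun k hk => hS (k + 1) (by omega)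
    have hd : EqOn (deriv (S 0)) (S 1) U := fun x hx => (hS 0 (Nat.zero_le _) x hx).deriv
    constructor
    · push_cast
      exact (contDiffOn_succ_iff_deriv_of_isOpen hU).2
        ⟨fun x hx => (hS 0 (Nat.zero_le _) x hx).differentiableAt.differentiableWithinAt,
          by simp, h₁.congr hd⟩
    · intro x hx
      rw [iteratedDeriv_succ', (hd.eventuallyEq_of_mem (hU.mem_nhds hx)).iteratedDeriv_eq]
      exact h₂ hx

/-- The `j`-th term of the series defining `KM`. -/
noncomputable def KMterm (M : ℝ → ℝ) (t : ℝ) (j : ℕ) (s : ℝ) : ℝ :=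
  ((-s) ^ j / (j.factorial : ℝ)) * convPow M j (t - s)

lemma contDiff_KMterm {n : ℕ} {M : ℝ → ℝ} (hM : ContDiff ℝ n M) (t : ℝ) (j : ℕ) :
    ContDiff ℝ n (KMterm M t j) := by
  have := contDiff_convPow hM j
  unfold KMterm
  fun_prop

lemma iteratedDeriv_KMterm {n : ℕ} {M : ℝ → ℝ} (hM : ContDiff ℝ n M) (t : ℝ) (j : ℕ) (s : ℝ) :
    iteratedDeriv n (KMterm M t j) s = (-1) ^ n * ∑ a ∈ Finset.range (n + 1),
      (n.choose a : ℝ) * (j.descFactorial a * (-s) ^ (j - a) / j.factorial) *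
        iteratedDeriv (n - a) (convPow M j) (t - s) := by
  have h₁ : ContDiff ℝ n fun s : ℝ => (-s) ^ j / (j.factorial : ℝ) := by fun_prop
  have h₂ : ContDiff ℝ n fun s : ℝ => convPow M j (t - s) := by
    have := contDiff_convPow hM j
    fun_prop
  unfold KMterm
  rw [iteratedDeriv_fun_mul h₁.contDiffAt h₂.contDiffAt, Finset.mul_sum]
  refine Finset.sum_congr rfl fun a ha => ?_
  have ha' : a ≤ n := by simpa [Nat.lt_succ_iff] using ha
  have h₃ : iteratedDeriv a (fun s : ℝ => (-s) ^ j / (j.factorial : ℝ)) s =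
      (-1) ^ a * (j.descFactorial a * (-s) ^ (j - a) / j.factorial) := by
    simp only [div_eq_mul_inv]
    rw [iteratedDeriv_mul_const_field, iteratedDeriv_comp_neg a (fun s : ℝ => s ^ j),
      iteratedDeriv_pow, smul_eq_mul]
    ring
  rw [h₃, iteratedDeriv_comp_const_sub]
  simp only [smul_eq_mul]
  obtain ⟨b, rfl⟩ := Nat.exists_eq_add_of_le ha'
  rw [Nat.add_sub_cancel_left, pow_add]
  ring

lemma exists_bound_iteratedDeriv_KMterm {n : ℕ} {M : ℝ → ℝ} (hM : ContDiff ℝ n M) (t R : ℝ) :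
    ∃ A B, ∀ k ≤ n, ∀ j, ∀ s ∈ Ioo (-R) R,
      |iteratedDeriv k (KMterm M t j) s| ≤ B * (A ^ j / j.factorial) := by
  obtain ⟨A, B, hA, hB, h⟩ := exists_bound_iteratedDeriv_convPow hM (|t| + |R|)
  refine ⟨2 * (|R| + 1) * A, (n + 1) * (2 ^ n * n.factorial * B), fun k hk j s hs => ?_⟩
  rw [iteratedDeriv_KMterm (hM.of_le (by exact_mod_cast hk)), abs_mul, abs_neg_one_pow, one_mul]
  have hs1 : |s| ≤ |R| := (abs_le.2 ⟨hs.1.le, hs.2.le⟩).trans (le_abs_self R)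
  have hts : t - s ∈ Icc (-(|t| + |R|)) (|t| + |R|) :=
    abs_le.1 ((abs_sub t s).trans (by gcongr))
  have hterm : ∀ a ∈ Finset.range (k + 1),
      |(k.choose a : ℝ) * (j.descFactorial a * (-s) ^ (j - a) / j.factorial) *
        iteratedDeriv (k - a) (convPow M j) (t - s)| ≤
      2 ^ n * n.factorial * B * ((2 * (|R| + 1) * A) ^ j / j.factorial) := by
    intro a ha
    have ha' : a ≤ k := by simpa [Nat.lt_succ_iff] using ha
    rw [abs_mul, abs_mul, abs_div, abs_mul, abs_pow, abs_neg, Nat.abs_cast, Nat.abs_cast,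
      Nat.abs_cast]
    have e₁ : (k.choose a : ℝ) ≤ 2 ^ n := by
      exact_mod_cast (Nat.choose_le_two_pow k a).trans (Nat.pow_le_pow_right two_pos hk)
    have e₂ : (j.descFactorial a : ℝ) ≤ n.factorial * 2 ^ j := by
      rw [Nat.descFactorial_eq_factorial_mul_choose]
      exact_mod_cast Nat.mul_le_mul (Nat.factorial_le (ha'.trans hk)) (Nat.choose_le_two_pow j a)
    have e₃ : |s| ^ (j - a) ≤ (|R| + 1) ^ j :=
      (pow_le_pow_left₀ (abs_nonneg s) (by linarith) _).trans
        (pow_le_pow_right₀ (by linarith [abs_nonneg R]) (Nat.sub_le j a))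
    have e₄ := h j (k - a) (by omega) (t - s) hts
    calc _ ≤ (2 ^ n : ℝ) * (n.factorial * 2 ^ j * (|R| + 1) ^ j / j.factorial) * (A ^ j * B) := by
          gcongr
      _ = _ := by rw [mul_pow, mul_pow]; ring
  refine (Finset.abs_sum_le_sum_abs _ _).trans ((Finset.sum_le_sum hterm).trans ?_)
  rw [Finset.sum_const, nsmul_eq_mul, Finset.card_range, mul_assoc (_ + 1 : ℝ)]
  have hk' : (k : ℝ) ≤ n := by exact_mod_cast hk
  push_cast
  gcongr

lemma KM_contDiffAt_and_iteratedDeriv {l : ℕ} {M : ℝ → ℝ} (hM : ContDiff ℝ (l + 1) M)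
    (t s : ℝ) :
    ContDiffAt ℝ l (KM M t) s ∧
      iteratedDeriv l (KM M t) s = ∑' j, iteratedDeriv l (KMterm M t j) s := by
  have hM' : ContDiff ℝ (l + 1 : ℕ) M := by exact_mod_cast hM
  obtain ⟨A, B, h⟩ := exists_bound_iteratedDeriv_KMterm hM' t (|s| + 1)
  have hsum : Summable fun j : ℕ => B * (A ^ j / j.factorial) :=
    (Real.summable_pow_div_factorial A).mul_left B
  have hs : s ∈ Ioo (-(|s| + 1)) (|s| + 1) := abs_lt.1 (lt_add_one |s|)
  have key := contDiffOn_and_iteratedDeriv_eq (n := l) (U := Ioo (-(|s| + 1)) (|s| + 1)) isOpen_Ioo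
    (S := fun k x => ∑' j, iteratedDeriv k (KMterm M t j) x) fun k hk x hx =>
      hasDerivAt_tsum_of_isPreconnected hsum isOpen_Ioo isPreconnected_Ioo
        (fun j y _ => by
          rw [iteratedDeriv_succ]
          exact ((contDiff_KMterm hM' t j).differentiable_iteratedDeriv k
            (by exact_mod_cast Nat.lt_succ_of_le hk) y).hasDerivAt)
        (fun j y hy => h (k + 1) (by omega) j y hy) hs
        (.of_norm_bounded hsum fun j => h k (by omega) j s hs) hx
  simp only [iteratedDeriv_zero] at key
  exact ⟨key.1.contDiffAt (isOpen_Ioo.mem_nhds hs), key.2 hs⟩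

lemma iteratedDeriv_KMterm_zero {n : ℕ} {M : ℝ → ℝ} (hM : ContDiff ℝ n M) (t : ℝ) (j : ℕ) :
    iteratedDeriv n (KMterm M t j) 0 =
      (-1) ^ n * ((n.choose j : ℝ) * iteratedDeriv (n - j) (convPow M j) t) := by
  rw [iteratedDeriv_KMterm hM, neg_zero, sub_zero]
  congr 1
  rw [Finset.sum_eq_single j]
  · rw [Nat.descFactorial_self, Nat.sub_self, pow_zero, mul_one, div_self (by positivity), mul_one]
  · intro a _ ha
    rcases ha.lt_or_gt with h | h
    · simp [zero_pow (Nat.sub_ne_zero_of_lt h)]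
    · simp [Nat.descFactorial_of_lt h]
  · intro h
    simp [Nat.choose_eq_zero_of_lt (show n < j by simpa [Nat.lt_succ_iff] using h)]

lemma iteratedDeriv_KMterm_self_eq_zero {n j : ℕ} {M : ℝ → ℝ} (hM : ContDiff ℝ n M) (t : ℝ)
    (hj : n + 2 ≤ j) : iteratedDeriv n (KMterm M t j) t = 0 := by
  rw [iteratedDeriv_KMterm hM, sub_self, Finset.sum_eq_zero, mul_zero]
  intro a _
  rw [iteratedDeriv_convPow_zero j (hM.of_le (by exact_mod_cast Nat.sub_le n a)) (by omega),
    mul_zero]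

lemma iteratedDeriv_KMterm_self {n : ℕ} {M : ℝ → ℝ} (hM : ContDiff ℝ n M) (t : ℝ) (j : ℕ) :
    iteratedDeriv n (KMterm M t j) t =
      (-1) ^ n * ((n.choose j : ℝ) * iteratedDeriv (n - j) (convPow M j) 0 +
        ∑ m ∈ Finset.Icc 1 j, if 2 * j ≤ m + n + 1 then
          (n.choose (n + m - j) : ℝ) * iteratedDeriv (n + m - j) (convPow M j) 0 *
            ((-t) ^ m / (m.factorial : ℝ)) else 0) := by
  rw [iteratedDeriv_KMterm hM, sub_self]
  congr 1
  set G : ℕ → ℝ := fun a => (n.choose a : ℝ) *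
    (j.descFactorial a * (-t) ^ (j - a) / j.factorial) *
      iteratedDeriv (n - a) (convPow M j) 0 with hG
  have hrange : ∑ a ∈ Finset.range (n + 1), G a = ∑ a ∈ Finset.range (j + 1), G a := by
    rcases le_total n j with h | h
    · refine Finset.sum_subset (Finset.range_mono (by omega)) fun a _ ha => ?_
      simp [hG, Nat.choose_eq_zero_of_lt (show n < a by simpa [Nat.lt_succ_iff] using ha)]
    · refine (Finset.sum_subset (Finset.range_mono (by omega)) fun a _ ha => ?_).symm
      simp [hG, Nat.descFactorial_of_lt (show j < a by simpa [Nat.lt_succ_iff] using ha)]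
  rw [hrange, Finset.sum_range_succ, add_comm]
  congr 1
  · simp only [hG]
    rw [Nat.descFactorial_self, Nat.sub_self, pow_zero, mul_one, div_self (by positivity), mul_one]
  · refine Finset.sum_nbij' (fun a => j - a) (fun m => j - m) ?_ ?_ ?_ ?_ ?_
    · intro a ha
      simp only [Finset.mem_range, Finset.mem_Icc] at *
      omega
    · intro m hm
      simp only [Finset.mem_range, Finset.mem_Icc] at *
      omega
    · intro a ha
      simp only [Finset.mem_range] at ha
      omega
    · intro m hm
      simp only [Finset.mem_Icc] at hm
      omega
    · intro a ha
      simp only [Finset.mem_range] at ha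
      rw [show n + (j - a) - j = n - a by omega]
      simp only [hG]
      split_ifs with h
      · have hfac : ((j - a).factorial : ℝ) * j.descFactorial a = j.factorial := by
          exact_mod_cast Nat.factorial_mul_descFactorial ha.le
        have hpos : ((j - a).factorial : ℝ) ≠ 0 := by positivity
        have hdesc : (j.descFactorial a : ℝ) ≠ 0 := by
          exact_mod_cast (Nat.descFactorial_pos.2 ha.le).ne'
        rw [Nat.choose_symm (show a ≤ n by omega), ← hfac]
        field_simp
      · by_cases han : a ≤ n
        · rw [iteratedDeriv_convPow_zero j (hM.of_le (by exact_mod_cast Nat.sub_le n a))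
            (by omega), mul_zero]
        · simp [Nat.choose_eq_zero_of_lt (not_le.1 han)]

lemma KM_congr {M N : ℝ → ℝ} (h : EqOn M N (Ici 0)) (t : ℝ) :
    EqOn (KM M t) (KM N t) (Iic t) := fun s hs =>
  tsum_congr fun j => by rw [convPow_congr h j (mem_Ici.2 (sub_nonneg.2 (mem_Iic.1 hs)))]

lemma iteratedDerivWithin_convPow_eq {n : ℕ} {M N : ℝ → ℝ} (h : EqOn M N (Ici 0))
    (hN : ContDiff ℝ n N) (j : ℕ) {x : ℝ} (hx : 0 ≤ x) {i : ℕ} (hi : i ≤ n) :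
    iteratedDerivWithin i (convPow M j) (Ici 0) x = iteratedDeriv i (convPow N j) x := by
  rw [iteratedDerivWithin_congr (convPow_congr h j) hx]
  exact iteratedDerivWithin_eq_iteratedDeriv (uniqueDiffOn_Ici 0)
    ((contDiff_convPow hN j).of_le (by exact_mod_cast hi)).contDiffAt hx

lemma hcoef_eq {n : ℕ} {M N : ℝ → ℝ} (h : EqOn M N (Ici 0))
    (hN : ContDiff ℝ n N) {t : ℝ} (ht : 0 ≤ t) {k : ℕ} (hk : n < k) :
    hcoef M n t = ∑ j ∈ Finset.range k,
      (-1) ^ n * ((n.choose j : ℝ) * iteratedDeriv (n - j) (convPow N j) t) := by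
  rw [hcoef, Finset.mul_sum]
  have hsub : Finset.range (n + 1) ⊆ Finset.range k := Finset.range_mono hk
  rw [← Finset.sum_subset hsub fun j _ hj => by
    simp [Nat.choose_eq_zero_of_lt (show n < j by simpa [Nat.lt_succ_iff] using hj)]]
  refine Finset.sum_congr rfl fun j hj => ?_
  have hj' : j ≤ n := by simpa [Nat.lt_succ_iff] using hj
  rw [Nat.choose_symm hj', iteratedDerivWithin_convPow_eq h hN j ht (Nat.sub_le n j)]

/-- For `M ∈ C^∞([0,∞))`, every `l ≥ 0` and every `t ≥ 0`, the `l`-th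
derivative of `s ↦ K_M(t,s)` (taken within the domain `s ≤ t`, i.e. from the left at `s = t`)
satisfies `∂_s^l K_M(t,s)|_{s=0} = h_l(t)` and `∂_s^l K_M(t,s)|_{s=t} = −p_l(t)`. -/
theorem KM_boundary_values
    (M : ℝ → ℝ) (hM : ContDiffOn ℝ (⊤ : ℕ∞) M (Set.Ici 0)) :
    ∀ (l : ℕ) (t : ℝ), 0 ≤ t →
      iteratedDerivWithin l (fun s => KM M t s) (Set.Iic t) 0 = hcoef M l t ∧
      iteratedDerivWithin l (fun s => KM M t s) (Set.Iic t) t = -pcoef M l t := by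
  intro l t ht
  obtain ⟨N, hN, hMN⟩ := exists_contDiff_eqOn_Ici (n := l + 1)
    (hM.of_le (by exact_mod_cast le_top))
  have hNl : ContDiff ℝ l N := hN.of_le (by exact_mod_cast l.le_succ)
  have hD : ∀ s ≤ t, iteratedDerivWithin l (fun s => KM M t s) (Set.Iic t) s =
      ∑' j, iteratedDeriv l (KMterm N t j) s := by
    intro s hs
    obtain ⟨h₁, h₂⟩ := KM_contDiffAt_and_iteratedDeriv (l := l) (by exact_mod_cast hN) t s
    rw [iteratedDerivWithin_congr (KM_congr hMN t) hs,
      iteratedDerivWithin_eq_iteratedDeriv (uniqueDiffOn_Iic t) h₁ hs, h₂]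
  refine ⟨?_, ?_⟩
  · rw [hD 0 ht, hcoef_eq hMN hNl ht l.lt_succ_self]
    simp only [iteratedDeriv_KMterm_zero hNl]
    refine tsum_eq_sum fun j hj => ?_
    simp [Nat.choose_eq_zero_of_lt (show l < j by simpa [Nat.lt_succ_iff] using hj)]
  · rw [hD t le_rfl, tsum_eq_sum (s := Finset.range (l + 2)) fun j hj =>
      iteratedDeriv_KMterm_self_eq_zero hNl t (by simpa using hj)]
    simp only [iteratedDeriv_KMterm_self hNl, mul_add, Finset.sum_add_distrib]
    rw [← hcoef_eq hMN hNl le_rfl (by omega), ← Finset.mul_sum, pcoef, neg_add, neg_neg, pow_succ,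
      mul_neg_one, neg_mul, neg_neg]
    congr 2
    have hsub : Finset.Icc 1 (l + 1) ⊆ Finset.range (l + 2) := fun j hj => by
      simp only [Finset.mem_range, Finset.mem_Icc] at *
      omega
    rw [← Finset.sum_subset hsub fun j hj hj' => by
      obtain rfl : j = 0 := by
        simp only [Finset.mem_range, Finset.mem_Icc] at *
        omega
      simp]
    refine Finset.sum_congr rfl fun j hj => Finset.sum_congr rfl fun m hm => ?_
    simp only [Finset.mem_Icc] at hm
    rw [iteratedDerivWithin_convPow_eq hMN hNl j le_rfl (by omega)]
end
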